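/- arXiv:1605.00384 — 3 statements merged into one kernel-verified Lean document; each statement's English description precedes it below -/
import Mathlib

section
/- Let M = x_0^{d_0} ⋯ x_n^{d_n} ∈ ℂ[x_0,…,x_n] with 1 ≤ d_0 ≤ d_1 ≤ ⋯ ≤ d_n, and let m = max{ i : d_i = d_0 }. Then for a nonzero vector (p_0,…,p_n) ∈ ℂ^{n+1}, the linear form L = p_0x_0 + ⋯ + p_nx_n lies in the Waring locus W_M if and only if p_0 p_1 ⋯ p_m ≠ 0; that is, the forbidden locus is F_M = V(X_0 X_1 ⋯ X_m) ⊂ ℙ^n. -/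
open MvPolynomial

noncomputable section

/-- The linear form `c₀x₀ + ⋯ + cₙxₙ` with coefficient vector `c`. -/
def lin {σ : Type*} [Fintype σ] (c : σ → ℂ) : MvPolynomial σ ℂ :=
  ∑ i, C (c i) * X i

/-- `F` admits a Waring decomposition `F = L₁^d + ⋯ + L_r^d`. -/
def HasWaringDecomp {σ : Type*} [Fintype σ] (d : ℕ) (F : MvPolynomial σ ℂ) (r : ℕ) : Prop :=
  ∃ L : Fin r → σ → ℂ, F = ∑ j, lin (L j) ^ d

/-- The Waring rank of `F` (as a form of degree `d`). -/
def waringRank {σ : Type*} [Fintype σ] (d : ℕ) (F : MvPolynomial σ ℂ) : ℕ :=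
  sInf {r | HasWaringDecomp d F r}

/-- The linear form with coefficient vector `a` lies in the Waring locus of `F`:
there are linear forms `L₂, …, L_r` with `r = rk F` such that `F` lies in the
`ℂ`-linear span of `L^d, L₂^d, …, L_r^d`. -/
def InWaringLocus {σ : Type*} [Fintype σ] (d : ℕ) (F : MvPolynomial σ ℂ) (a : σ → ℂ) : Prop :=
  ∃ (c : Fin (waringRank d F) → ℂ) (L : Fin (waringRank d F) → σ → ℂ)
    (j₀ : Fin (waringRank d F)), L j₀ = a ∧ F = ∑ j, c j • lin (L j) ^ d

lemma sum_lin_pow {n : ℕ} {ι : Type*} [Fintype ι] (D : ℕ) (c : ι → ℂ) (L : ι → Fin (n+1) → ℂ) :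
    ∑ j, c j • lin (L j) ^ D = ∑ k ∈ Finset.piAntidiag Finset.univ D,
      C ((Nat.multinomial Finset.univ k : ℂ) * ∑ j, c j * ∏ i, L j i ^ k i) *
        ∏ i, (X i : MvPolynomial (Fin (n+1)) ℂ) ^ k i := by
  simp only [lin, Finset.sum_pow_eq_sum_piAntidiag, Finset.smul_sum]
  rw [Finset.sum_comm]
  refine Finset.sum_congr rfl fun k _ => ?_
  simp only [mul_pow, Finset.prod_mul_distrib, map_mul, map_sum, Finset.mul_sum, Finset.sum_mul,
    map_prod, map_pow, smul_eq_C_mul, map_natCast]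
  refine Finset.sum_congr rfl fun j _ => ?_
  ring

lemma prod_X_eq {n : ℕ} (k : Fin (n+1) → ℕ) :
    ∏ i, (X i : MvPolynomial (Fin (n+1)) ℂ) ^ k i
      = monomial (Finsupp.equivFunOnFinite.symm k) 1 := by
  rw [monomial_eq, Finsupp.prod_fintype _ _ (by simp)]
  simp

lemma moments {n : ℕ} {ι : Type*} [Fintype ι] (d : Fin (n+1) → ℕ) (c : ι → ℂ)
    (L : ι → Fin (n+1) → ℂ)
    (h : ∏ i, (X i : MvPolynomial (Fin (n + 1)) ℂ) ^ d i = ∑ j, c j • lin (L j) ^ (∑ i, d i))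
    (a : Fin (n+1) → ℕ) (ha : ∑ i, a i = ∑ i, d i) :
    (∑ j, c j * ∏ i, L j i ^ a i = 0) ↔ a ≠ d := by
  rw [sum_lin_pow] at h
  have h2 := congrArg (coeff (Finsupp.equivFunOnFinite.symm a)) h
  simp only [prod_X_eq, coeff_sum, coeff_C_mul, coeff_monomial,
    Finsupp.equivFunOnFinite.symm.injective.eq_iff, mul_ite, mul_one, mul_zero] at h2
  have hmem : a ∈ Finset.piAntidiag Finset.univ (∑ i, d i) := by simp [ha]
  rw [Finset.sum_ite_eq' _ a, if_pos hmem] at h2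
  have hm : (Nat.multinomial Finset.univ a : ℂ) ≠ 0 := by
    exact_mod_cast (Nat.multinomial_pos _ _).ne'
  by_cases e : d = a
  · simp only [e, if_true] at h2
    simp only [e, ne_eq, not_true, iff_false]
    intro h0
    rw [h0] at h2
    simp at h2
  · rw [if_neg e] at h2
    have := (mul_eq_zero.mp h2.symm).resolve_left hm
    simp only [this, true_iff]
    exact fun h => e h.symm

lemma of_moments {n : ℕ} {ι : Type*} [Fintype ι] (d : Fin (n+1) → ℕ) (c : ι → ℂ)
    (L : ι → Fin (n+1) → ℂ)
    (h : ∀ a : Fin (n+1) → ℕ, ∑ i, a i = ∑ i, d i →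
      ((∑ j, c j * ∏ i, L j i ^ a i = 0) ↔ a ≠ d)) :
    ∃ c' : ι → ℂ, ∏ i, (X i : MvPolynomial (Fin (n + 1)) ℂ) ^ d i
      = ∑ j, c' j • lin (L j) ^ (∑ i, d i) := by
  have hm : (Nat.multinomial Finset.univ d : ℂ) ≠ 0 := by
    exact_mod_cast (Nat.multinomial_pos _ _).ne'
  have hd : ∑ j, c j * ∏ i, L j i ^ d i ≠ 0 := by
    intro h0
    exact ((h d rfl).mp h0) rfl
  set K : ℂ := (Nat.multinomial Finset.univ d : ℂ) * ∑ j, c j * ∏ i, L j i ^ d i with hK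
  have hK0 : K ≠ 0 := mul_ne_zero hm hd
  refine ⟨fun j => K⁻¹ * c j, ?_⟩
  simp only [mul_smul]
  rw [← Finset.smul_sum, sum_lin_pow, Finset.sum_eq_single d]
  · rw [← hK, ← smul_eq_C_mul, smul_smul, inv_mul_cancel₀ hK0, one_smul]
  · intro a ha hne
    rw [(h a (by simpa using ha)).mpr hne]
    simp
  · intro hx
    simp at hx

lemma lower {n : ℕ} {ι : Type*} [Fintype ι] (d : Fin (n+1) → ℕ) (c : ι → ℂ)
    (L : ι → Fin (n+1) → ℂ) (i : Fin (n+1)) (hi : 1 ≤ d i)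
    (h : ∏ i, (X i : MvPolynomial (Fin (n + 1)) ℂ) ^ d i = ∑ j, c j • lin (L j) ^ (∑ i, d i)) :
    ∏ k ∈ Finset.univ.erase i, (d k + 1) ≤ Fintype.card {j // L j i ≠ 0} := by
  classical
  set b : Fin (n+1) → ℕ := Function.update d i 0 with hb
  have hbi : b i = 0 := by simp [b]
  have hbk : ∀ k, k ≠ i → b k = d k := fun k hk => by simp [b, hk]
  have hbsum : ∑ k, b k + d i = ∑ k, d k := by
    rw [hb, Finset.sum_update_of_mem (Finset.mem_univ _), ← Finset.sum_sdiff (Finset.subset_univ {i})]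
    simp
  have hcard : Fintype.card (Finset.Iic b) = ∏ k ∈ Finset.univ.erase i, (d k + 1) := by
    rw [Fintype.card_coe, Pi.card_Iic, ← Finset.mul_prod_erase _ _ (Finset.mem_univ i)]
    simp only [Nat.card_Iic, hbi, zero_add, one_mul]
    exact Finset.prod_congr rfl fun k hk => by rw [hbk k (Finset.ne_of_mem_erase hk)]
  -- key functional
  have key : ∀ g : Fin (n+1) → ℕ, g i = 0 → ∑ k, g k ≤ ∑ k, b k →
      ((∑ j : {j // L j i ≠ 0}, (c j * L j i ^ (∑ k, d k)) * ∏ k, (L j k / L j i) ^ g k = 0)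
        ↔ g ≠ b) := by
    intro g hg hle
    set a : Fin (n+1) → ℕ := Function.update g i (∑ k, d k - ∑ k, g k) with ha
    have hgs : ∑ k, g k = ∑ k ∈ Finset.univ.erase i, g k := by
      rw [← Finset.add_sum_erase _ _ (Finset.mem_univ i), hg, zero_add]
    have hai : a i = ∑ k, d k - ∑ k, g k := by simp [a]
    have hak : ∀ k, k ≠ i → a k = g k := fun k hk => by simp [a, hk]
    have has : ∑ k, a k = ∑ k, d k := by
      rw [← Finset.add_sum_erase _ _ (Finset.mem_univ i), hai,
        Finset.sum_congr rfl (fun k hk => hak k (Finset.ne_of_mem_erase hk)), ← hgs]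
      omega
    have hiff : a ≠ d ↔ g ≠ b := by
      rw [not_iff_not]
      constructor
      · intro e
        funext k
        by_cases hk : k = i
        · rw [hk, hg, hbi]
        · rw [← hak k hk, hbk k hk, e]
      · intro e
        funext k
        by_cases hk : k = i
        · rw [hk, hai, e]; omega
        · rw [hak k hk, e, hbk k hk]
    rw [← hiff, ← moments d c L h a has]
    have : ∑ j, c j * ∏ k, L j k ^ a k = ∑ j : {j // L j i ≠ 0},
        (c j * L j i ^ (∑ k, d k)) * ∏ k, (L j k / L j i) ^ g k := by
      rw [← Fintype.sum_subtype_add_sum_subtype (fun j => L j i ≠ 0)]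
      have hzero : ∑ j : {j // ¬ L j i ≠ 0}, c j * ∏ k, L j k ^ a k = 0 := by
        refine Finset.sum_eq_zero fun j _ => ?_
        rw [Finset.prod_eq_zero (Finset.mem_univ i), mul_zero]
        rw [not_not.mp j.2, zero_pow]
        omega
      rw [hzero, add_zero]
      refine Finset.sum_congr rfl fun j _ => ?_
      have hj := j.2
      rw [mul_assoc]
      congr 1
      rw [← Finset.mul_prod_erase _ _ (Finset.mem_univ i),
        ← Finset.mul_prod_erase _ (fun k => (L j k / L j i) ^ g k) (Finset.mem_univ i),
        hg, pow_zero, one_mul,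
        Finset.prod_congr rfl (fun k hk => by rw [hak k (Finset.ne_of_mem_erase hk)])]
      simp only [div_pow, Finset.prod_div_distrib]
      rw [Finset.prod_pow_eq_pow_sum, ← hgs, hai]
      have hsplit : L j i ^ (∑ k, d k) = L j i ^ (∑ k, d k - ∑ k, g k) * L j i ^ (∑ k, g k) := by
        rw [← pow_add]; congr 1; omega
      rw [hsplit]
      field_simp
    rw [this]
  have hli : LinearIndependent ℂ (fun (β : Finset.Iic b) (j : {j // L j i ≠ 0}) =>
      ∏ k, (L j k / L j i) ^ (β : Fin (n+1) → ℕ) k) := by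
    rw [Fintype.linearIndependent_iff]
    intro g hg
    by_contra hne
    push Not at hne
    obtain ⟨β₁, hβ₁⟩ := hne
    obtain ⟨β₀, hβ₀, hmx⟩ := Finset.exists_max_image
      (Finset.univ.filter fun β : Finset.Iic b => g β ≠ 0)
      (fun β => ∑ k, (β : Fin (n+1) → ℕ) k) ⟨β₁, by simp [hβ₁]⟩
    simp only [Finset.mem_filter, Finset.mem_univ, true_and] at hβ₀ hmx
    have hle : ∀ β : Finset.Iic b, (β : Fin (n+1) → ℕ) ≤ b := fun β => Finset.mem_Iic.mp β.2
    have hz : ∀ β : Finset.Iic b, (β : Fin (n+1) → ℕ) i = 0 := fun β => by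
      have := hle β i
      rw [hbi] at this
      exact Nat.le_zero.mp this
    -- pair with functional
    have hpair : ∑ β : Finset.Iic b, g β * ∑ j : {j // L j i ≠ 0},
        (c j * L j i ^ (∑ k, d k)) * ∏ k, (L j k / L j i) ^
          ((β : Fin (n+1) → ℕ) + (b - (β₀ : Fin (n+1) → ℕ))) k = 0 := by
      simp only [Finset.mul_sum]
      rw [Finset.sum_comm]
      refine Finset.sum_eq_zero fun j _ => ?_
      have := congrFun hg j
      simp only [Finset.sum_apply, Pi.smul_apply, smul_eq_mul, Pi.zero_apply] at this
      calc _ = (∑ β : Finset.Iic b, g β * ∏ k, (L j k / L j i) ^ (β : Fin (n+1) → ℕ) k) *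
            ((c j * L j i ^ (∑ k, d k)) *
              ∏ k, (L j k / L j i) ^ (b - (β₀ : Fin (n+1) → ℕ)) k) := by
            rw [Finset.sum_mul]
            refine Finset.sum_congr rfl fun β _ => ?_
            simp only [Pi.add_apply, pow_add, Finset.prod_mul_distrib]
            ring
        _ = 0 := by rw [this, zero_mul]
    have hb0 : (β₀ : Fin (n+1) → ℕ) + (b - (β₀ : Fin (n+1) → ℕ)) = b :=
      add_tsub_cancel_of_le (hle β₀)
    rw [Finset.sum_eq_single β₀] at hpair
    · rcases mul_eq_zero.mp hpair with h0 | h0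
      · exact hβ₀ h0
      · rw [hb0] at h0
        exact (key b hbi le_rfl).mp h0 rfl
    · intro β _ hβ
      by_cases h0 : g β = 0
      · rw [h0, zero_mul]
      · rw [(key _ _ _).mpr, mul_zero]
        · intro e
          exact hβ (Subtype.ext (add_right_cancel (e.trans hb0.symm)))
        · simp [hz, hbi]
        · have h1 := hmx β h0
          have h2 := congrArg (fun f => ∑ k, f k) hb0
          simp only [Pi.add_apply, Finset.sum_add_distrib] at h2 ⊢
          omega
    · simp
  have := hli.fintype_card_le_finrank
  rw [hcard] at this
  simpa using this

lemma root_sum (N : ℕ) (hN : 0 < N) : ∃ z : Fin N → ℂ, (∀ h : 0 < N, z ⟨0, h⟩ = 1) ∧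
    ∀ e : ℕ, ∑ j, z j ^ e = if N ∣ e then (N : ℂ) else 0 := by
  have hp := Complex.isPrimitiveRoot_exp N hN.ne'
  set ζ := Complex.exp (2 * Real.pi * Complex.I / N)
  refine ⟨fun j => ζ ^ (j : ℕ), by simp, fun e => ?_⟩
  have : ∀ j : Fin N, (ζ ^ (j:ℕ)) ^ e = (ζ ^ e) ^ (j:ℕ) := fun j => by
    rw [← pow_mul, ← pow_mul, mul_comm]
  simp only [this]
  rw [Fin.sum_univ_eq_sum_range (fun j => (ζ ^ e) ^ j) N]
  split_ifs with h
  · rw [(hp.pow_eq_one_iff_dvd e).mpr h]; simp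
  · have h1 : ζ ^ e ≠ 1 := fun h1 => h ((hp.pow_eq_one_iff_dvd e).mp h1)
    have := geom_sum_mul (ζ ^ e) N
    rw [← pow_mul, mul_comm e N, pow_mul, hp.pow_eq_one, one_pow, sub_self] at this
    exact (mul_eq_zero.mp this).resolve_right (sub_ne_zero.mpr h1)

lemma one_var (d d0 : ℕ) (hd : d0 ≤ d) (p : ℂ) (hp : p ≠ 0 ∨ d0 < d) :
    ∃ R w : Fin (d+1) → ℂ, R 0 = p ∧
      ∀ e, e ≤ d + d0 → ∑ j, w j * R j ^ e = if e = d then 1 else 0 := by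
  by_cases h0 : p = 0
  · have hlt := hp.resolve_left (by simp [h0])
    obtain ⟨z, -, hz⟩ := root_sum d (by omega)
    have hdc : (d:ℂ) ≠ 0 := by exact_mod_cast (by omega : d ≠ 0)
    refine ⟨Fin.cons 0 z, Fin.cons (-1) (fun _ => (d:ℂ)⁻¹), by simp [h0], fun e he => ?_⟩
    simp only [Fin.sum_univ_succ, Fin.cons_zero, Fin.cons_succ]
    rw [← Finset.mul_sum, hz]
    by_cases e0 : e = 0
    · subst e0
      have hne : (0 : ℕ) ≠ d := by omega
      simp [hdc, hne]
    · rw [zero_pow e0]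
      by_cases e1 : e = d
      · simp [e1, hdc]
      · have : ¬ d ∣ e := by
          rintro ⟨q, rfl⟩
          rcases q with _ | _ | q
          · simp at e0
          · simp at e1
          · nlinarith [Nat.zero_le (d * q)]
        simp [this, e1]
  · obtain ⟨z, hz0, hz⟩ := root_sum (d+1) (by omega)
    have hdc : ((d+1 : ℕ):ℂ) ≠ 0 := by exact_mod_cast (by omega : d + 1 ≠ 0)
    refine ⟨fun j => p * z j, fun j => z j * (((d+1 : ℕ):ℂ) * p ^ d)⁻¹, ?_, fun e he => ?_⟩
    · have := hz0 (by omega)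
      simp only [Fin.mk_zero] at this
      simp [this]
    · have : ∀ j, z j * (((d+1 : ℕ):ℂ) * p ^ d)⁻¹ * (p * z j) ^ e
          = ((((d+1 : ℕ):ℂ) * p ^ d)⁻¹ * p ^ e) * z j ^ (e+1) := fun j => by
        rw [mul_pow, pow_succ]; ring
      simp only [this]
      rw [← Finset.mul_sum, hz]
      by_cases e1 : e = d
      · subst e1
        simp only [dvd_refl, if_true]
        field_simp
      · have : ¬ (d+1) ∣ e+1 := by
          rintro ⟨q, hq⟩
          rcases q with _ | _ | q
          · simp at hq
          · simp at hq; exact e1 hq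
          · nlinarith [Nat.zero_le (d * q)]
        simp [this, e1]

lemma upper {n : ℕ} (d : Fin (n+1) → ℕ) (hmono : Monotone d) (p : Fin (n+1) → ℂ)
    (hp : ∀ k, p k ≠ 0 ∨ d 0 < d k) (hp0 : p 0 ≠ 0) (r : ℕ)
    (hr : r = ∏ k ∈ Finset.univ.erase 0, (d k + 1)) :
    ∃ (c : Fin r → ℂ) (L : Fin r → Fin (n+1) → ℂ) (j₀ : Fin r), L j₀ = p ∧
      ∏ i, (X i : MvPolynomial (Fin (n + 1)) ℂ) ^ d i = ∑ j, c j • lin (L j) ^ (∑ i, d i) := by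
  classical
  have hex : ∀ k : Fin (n+1), ∃ (N : ℕ) (R w : Fin (N+1) → ℂ), R 0 = p k ∧
      (k = 0 → N = 0 ∧ ∀ e, ∑ j, w j * R j ^ e ≠ 0) ∧
      (k ≠ 0 → N = d k ∧ ∀ e, e ≤ d k + d 0 → ∑ j, w j * R j ^ e = if e = d k then 1 else 0) := by
    intro k
    by_cases hk : k = 0
    · subst hk
      exact ⟨0, fun _ => p 0, fun _ => 1, rfl, fun _ => ⟨rfl, fun e => by simp [hp0]⟩,
        fun h => absurd rfl h⟩
    · obtain ⟨R, w, h1, h2⟩ := one_var (d k) (d 0) (hmono (Fin.zero_le k)) (p k) (hp k)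
      exact ⟨d k, R, w, h1, fun h => absurd h hk, fun _ => ⟨rfl, h2⟩⟩
  choose N R w hR hz hnz using hex
  have hcard : Fintype.card (∀ k, Fin (N k + 1)) = r := by
    rw [Fintype.card_pi, hr, ← Finset.mul_prod_erase _ _ (Finset.mem_univ 0)]
    simp only [Fintype.card_fin, (hz 0 rfl).1, zero_add, one_mul]
    exact Finset.prod_congr rfl fun k hk => by rw [(hnz k (Finset.ne_of_mem_erase hk)).1]
  have hmom := of_moments d (fun q : ∀ k, Fin (N k + 1) => ∏ k, w k (q k))
    (fun q k => R k (q k)) (by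
      intro a ha
      have : ∑ q : (∀ k, Fin (N k + 1)), (∏ k, w k (q k)) * ∏ k, R k (q k) ^ a k
          = ∏ k, ∑ j, w k j * R k j ^ a k := by
        rw [Finset.prod_univ_sum, Fintype.piFinset_univ]
        simp only [Finset.prod_mul_distrib]
      rw [this, Finset.prod_eq_zero_iff]
      constructor
      · rintro ⟨k, -, hk⟩ rfl
        by_cases h : k = 0
        · exact (hz k h).2 _ hk
        · rw [(hnz k h).2 _ (by omega)] at hk
          simp at hk
      · intro hne
        by_contra hcon
        push Not at hcon
        apply hne
        have hge : ∀ k, k ≠ 0 → a k ≤ d k + d 0 → a k = d k := by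
          intro k hk hle
          have := hcon k (Finset.mem_univ k)
          rw [(hnz k hk).2 _ hle] at this
          by_contra h
          simp [h] at this
        have hge2 : ∀ k, k ≠ 0 → d k ≤ a k := by
          intro k hk
          by_contra h
          have := hge k hk (by omega)
          omega
        have hs1 := Finset.add_sum_erase Finset.univ a (Finset.mem_univ 0)
        have hs2 := Finset.add_sum_erase Finset.univ d (Finset.mem_univ 0)
        have heq : ∀ k, k ≠ 0 → a k = d k := by
          intro k hk
          apply hge k hk
          have hmem : k ∈ Finset.univ.erase (0 : Fin (n+1)) := by simp [hk]
          have hs3 := Finset.add_sum_erase _ a hmem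
          have hs4 := Finset.add_sum_erase _ d hmem
          have : ∑ x ∈ (Finset.univ.erase 0).erase k, d x
              ≤ ∑ x ∈ (Finset.univ.erase 0).erase k, a x :=
            Finset.sum_le_sum fun x hx =>
              hge2 x (Finset.ne_of_mem_erase (Finset.mem_of_mem_erase hx))
          omega
        funext k
        by_cases hk : k = 0
        · have : ∑ x ∈ Finset.univ.erase 0, a x = ∑ x ∈ Finset.univ.erase 0, d x :=
            Finset.sum_congr rfl fun x hx => heq x (Finset.ne_of_mem_erase hx)
          subst hk
          omega
        · exact heq k hk)
  obtain ⟨c, hc⟩ := hmom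
  let E := Fintype.equivFinOfCardEq hcard
  refine ⟨fun j => c (E.symm j), fun j k => R k (E.symm j k), E (fun k => 0), ?_, ?_⟩
  · funext k
    simp [hR]
  · rw [hc]
    exact (Equiv.sum_comp E.symm
      (fun q => c q • lin (fun k => R k (q k)) ^ (∑ i, d i))).symm

lemma lin_smul' {n : ℕ} (t : ℂ) (v : Fin (n+1) → ℂ) : lin (t • v) = C t * lin v := by
  simp [lin, Finset.mul_sum, mul_assoc]

lemma rank_eq {n : ℕ} (d : Fin (n+1) → ℕ) (hd0 : 1 ≤ d 0) (hmono : Monotone d) :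
    waringRank (∑ i, d i) (∏ i, (X i : MvPolynomial (Fin (n + 1)) ℂ) ^ d i)
      = ∏ k ∈ Finset.univ.erase 0, (d k + 1) := by
  have hD : 0 < ∑ i, d i :=
    lt_of_lt_of_le hd0 (Finset.single_le_sum (f := d) (fun _ _ => Nat.zero_le _) (Finset.mem_univ 0))
  have hmem : HasWaringDecomp (∑ i, d i) (∏ i, (X i : MvPolynomial (Fin (n + 1)) ℂ) ^ d i)
      (∏ k ∈ Finset.univ.erase 0, (d k + 1)) := by
    obtain ⟨c, L, -, -, h⟩ := upper d hmono 1 (fun k => Or.inl one_ne_zero) one_ne_zero _ rfl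
    choose t ht using fun j => IsAlgClosed.exists_pow_nat_eq (c j) hD
    refine ⟨fun j => t j • L j, ?_⟩
    rw [h]
    refine Finset.sum_congr rfl fun j _ => ?_
    rw [lin_smul', mul_pow, ← map_pow, ht, smul_eq_C_mul]
  apply le_antisymm (Nat.sInf_le hmem)
  refine le_csInf ⟨_, hmem⟩ fun r hr => ?_
  obtain ⟨L, hL⟩ := hr
  have := lower d (fun _ => 1) L 0 hd0 (by simpa using hL)
  refine this.trans ((Fintype.card_subtype_le _).trans (by simp))

/-- Waring locus of a monomial `x₀^{d₀} ⋯ xₙ^{dₙ}` with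
`1 ≤ d₀ ≤ ⋯ ≤ dₙ`: a nonzero linear form `p₀x₀ + ⋯ + pₙxₙ` lies in the Waring locus
iff `pᵢ ≠ 0` for all `i ≤ m`, where `m = max{i : dᵢ = d₀}`. -/
theorem waring_locus_monomial (n : ℕ) (d : Fin (n + 1) → ℕ) (hd0 : 1 ≤ d 0)
    (hmono : Monotone d) (m : Fin (n + 1)) (hm : d m = d 0)
    (hmax : ∀ i, d i = d 0 → i ≤ m) :
    ∀ p : Fin (n + 1) → ℂ, p ≠ 0 →
      (InWaringLocus (∑ i, d i) (∏ i, (X i : MvPolynomial (Fin (n + 1)) ℂ) ^ d i) p ↔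
        ∀ i, i ≤ m → p i ≠ 0) := by
  intro p hp
  have hrank := rank_eq d hd0 hmono
  constructor
  · rintro ⟨c, L, j₀, hj, hF⟩ i him hpi
    have hdi : d i = d 0 := le_antisymm ((hmono him).trans hm.le) (hmono (Fin.zero_le i))
    have hlow := lower d c L i (by omega) hF
    have hlt := Fintype.card_subtype_lt (p := fun j => L j i ≠ 0) (x := j₀)
      (by rw [hj, hpi]; simp)
    have e1 := Finset.mul_prod_erase Finset.univ (fun k => d k + 1) (Finset.mem_univ i)
    have e2 := Finset.mul_prod_erase Finset.univ (fun k => d k + 1)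
      (Finset.mem_univ (0 : Fin (n+1)))
    have e3 : ∏ k ∈ Finset.univ.erase i, (d k + 1) = ∏ k ∈ Finset.univ.erase 0, (d k + 1) := by
      apply Nat.eq_of_mul_eq_mul_left (Nat.succ_pos (d 0))
      rw [← e2, hdi] at e1
      exact e1
    rw [Fintype.card_fin] at hlt
    have hle := (hrank.trans e3.symm).le.trans hlow
    exact absurd hlt (not_lt.mpr (by convert hle))
  · intro h
    obtain ⟨c, L, j₀, hj, hF⟩ := upper d hmono p (fun k => by
      by_cases hk : d k = d 0
      · exact Or.inl (h k (hmax k hk))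
      · exact Or.inr (lt_of_le_of_ne (hmono (Fin.zero_le k)) (Ne.symm hk)))
      (h 0 (Fin.zero_le m)) _ hrank
    exact ⟨c, L, j₀, hj, hF⟩

end
end

section
/- Let F = y^2z − x^3 − xz^2 ∈ ℂ[x,y,z], a nodal plane cubic of Waring rank 4. Set g_1 = X^3 − 6Y^2Z + 3XZ^2 and g_2 = 9X^4Y^2 − 4Y^6 − 24XY^4Z − 30X^2Y^2Z^2 + 4X^3Z^3 − 3Y^2Z^4 − 12XZ^5 in ℂ[X,Y,Z]. Then for a nonzero triple (a,b,c) ∈ ℂ^3, the linear form ax + by + cz lies in the forbidden locus F_F if and only if g_1(a,b,c)·g_2(a,b,c) = 0; that is, F_F = V(g_1 g_2) ⊂ ℙ^2. -/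
open MvPolynomial

noncomputable section

/-- Polar form of the net of apolar conics. -/
def Bp (u v : Fin 3 → ℂ) : Fin 3 → ℂ :=
  ![(u 0 * v 1 + u 1 * v 0) / 2, u 0 * v 0 - 3 * u 2 * v 2,
    u 1 * v 1 + (u 0 * v 2 + u 2 * v 0) / 2]

/-- Explicit determinant of three vectors. -/
def det3 (u v w : Fin 3 → ℂ) : ℂ :=
  u 0 * (v 1 * w 2 - v 2 * w 1) - u 1 * (v 0 * w 2 - v 2 * w 0) + u 2 * (v 0 * w 1 - v 1 * w 0)

/-- The first polynomial. -/
def gOne (a : Fin 3 → ℂ) : ℂ := a 0 ^ 3 - 6 * a 1 ^ 2 * a 2 + 3 * a 0 * a 2 ^ 2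

/-- The second polynomial. -/
def gTwo (a : Fin 3 → ℂ) : ℂ :=
  9 * a 0 ^ 4 * a 1 ^ 2 - 4 * a 1 ^ 6 - 24 * a 0 * a 1 ^ 4 * a 2
    - 30 * a 0 ^ 2 * a 1 ^ 2 * a 2 ^ 2 + 4 * a 0 ^ 3 * a 2 ^ 3
    - 3 * a 1 ^ 2 * a 2 ^ 4 - 12 * a 0 * a 2 ^ 5

/-- Discriminant of a binary cubic. -/
def dsc (p q r w : ℂ) : ℂ :=
  q ^ 2 * r ^ 2 - 4 * p * r ^ 3 - 4 * q ^ 3 * w - 27 * p ^ 2 * w ^ 2 + 18 * p * q * r * w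

theorem Bp0 (u v : Fin 3 → ℂ) : Bp u v 0 = (u 0 * v 1 + u 1 * v 0) / 2 := by simp [Bp]
theorem Bp1 (u v : Fin 3 → ℂ) : Bp u v 1 = u 0 * v 0 - 3 * u 2 * v 2 := by simp [Bp]
theorem Bp2 (u v : Fin 3 → ℂ) : Bp u v 2 = u 1 * v 1 + (u 0 * v 2 + u 2 * v 0) / 2 := by
  simp [Bp]

theorem ext3 {u v : Fin 3 → ℂ} (h0 : u 0 = v 0) (h1 : u 1 = v 1) (h2 : u 2 = v 2) : u = v := by
  funext i; fin_cases i <;> assumption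

theorem Bp_comm (u v : Fin 3 → ℂ) : Bp u v = Bp v u := by
  apply ext3 <;> simp only [Bp0, Bp1, Bp2] <;> ring

theorem Bp_add_left (u v w : Fin 3 → ℂ) : Bp (u + v) w = Bp u w + Bp v w := by
  apply ext3 <;> simp only [Bp0, Bp1, Bp2, Pi.add_apply] <;> ring

theorem Bp_smul_left (c : ℂ) (v w : Fin 3 → ℂ) : Bp (c • v) w = c • Bp v w := by
  apply ext3 <;> simp only [Bp0, Bp1, Bp2, Pi.smul_apply, smul_eq_mul] <;> ring

theorem Bp_add_right (u v w : Fin 3 → ℂ) : Bp w (u + v) = Bp w u + Bp w v := by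
  rw [Bp_comm, Bp_add_left, Bp_comm u, Bp_comm v]

theorem Bp_smul_right (c : ℂ) (v w : Fin 3 → ℂ) : Bp w (c • v) = c • Bp w v := by
  rw [Bp_comm, Bp_smul_left, Bp_comm]

theorem Bp_self_eq_zero {u : Fin 3 → ℂ} (h : Bp u u = 0) : u = 0 := by
  have h0 := congrFun h 0
  have h1 := congrFun h 1
  have h2 := congrFun h 2
  simp only [Bp0, Bp1, Bp2, Pi.zero_apply] at h0 h1 h2
  have e0 : u 0 * u 1 = 0 := by linear_combination h0
  rcases mul_eq_zero.1 e0 with e | e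
  · have : u 2 = 0 := by
      have : u 2 * u 2 = 0 := by rw [e] at h1; linear_combination (-1/3) * h1
      exact mul_self_eq_zero.1 this
    have h3 : u 1 = 0 := by
      have : u 1 * u 1 = 0 := by rw [e] at h2; linear_combination h2
      exact mul_self_eq_zero.1 this
    exact ext3 e h3 this
  · have e1 : u 0 * u 2 = 0 := by rw [e] at h2; linear_combination h2
    rcases mul_eq_zero.1 e1 with e2 | e2
    · have : u 2 = 0 := by
        have : u 2 * u 2 = 0 := by rw [e2] at h1; linear_combination (-1/3) * h1
        exact mul_self_eq_zero.1 this
      exact ext3 e2 e this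
    · have : u 0 = 0 := by
        have : u 0 * u 0 = 0 := by rw [e2] at h1; linear_combination h1
        exact mul_self_eq_zero.1 this
      exact ext3 this e e2

theorem cramer (a u v w : Fin 3 → ℂ) :
    det3 a u v • w = det3 w u v • a + det3 a w v • u + det3 a u w • v := by
  apply ext3 <;> simp only [det3, Pi.add_apply, Pi.smul_apply, smul_eq_mul] <;> ring

theorem cramer' (a u v w : Fin 3 → ℂ) (h : det3 a u v ≠ 0) :
    ∃ x y z : ℂ, w = x • a + y • u + z • v := by
  refine ⟨det3 w u v / det3 a u v, det3 a w v / det3 a u v, det3 a u w / det3 a u v, ?_⟩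
  have := cramer a u v w
  have h2 : w = (det3 a u v)⁻¹ • (det3 a u v • w) := by
    rw [smul_smul, inv_mul_cancel₀ h, one_smul]
  rw [this] at h2
  refine h2.trans ?_
  simp only [smul_add, smul_smul, div_eq_inv_mul]

theorem exists_kernel {u v w : Fin 3 → ℂ} (h : det3 u v w = 0) :
    ∃ m : Fin 3 → ℂ, m ≠ 0 ∧ (u 0 * m 0 + u 1 * m 1 + u 2 * m 2 = 0) ∧
      (v 0 * m 0 + v 1 * m 1 + v 2 * m 2 = 0) ∧ (w 0 * m 0 + w 1 * m 1 + w 2 * m 2 = 0) := by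
  have hd : (Matrix.of ![u, v, w]).det = 0 := by
    rw [Matrix.det_fin_three]
    simp only [det3] at h
    simp
    linear_combination h
  obtain ⟨m, hm, h2⟩ := Matrix.exists_mulVec_eq_zero_iff.2 hd
  refine ⟨m, hm, ?_, ?_, ?_⟩
  · have := congrFun h2 0
    simpa [Matrix.mulVec, dotProduct, Fin.sum_univ_three] using this
  · have := congrFun h2 1
    simpa [Matrix.mulVec, dotProduct, Fin.sum_univ_three] using this
  · have := congrFun h2 2
    simpa [Matrix.mulVec, dotProduct, Fin.sum_univ_three] using this

theorem jac (a u v : Fin 3 → ℂ) :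
    det3 (Bp a a) (Bp a u) (Bp a v) = -(1 / 4) * gOne a * det3 a u v := by
  simp only [det3, Bp0, Bp1, Bp2, gOne]; ring

/-- The binary cubic attached to `a`. -/
def Cub (a v : Fin 3 → ℂ) : ℂ := det3 (Bp a a) (Bp a v) (Bp v v)

/-- First coefficient of the binary cubic. -/
def cP (a e : Fin 3 → ℂ) : ℂ := det3 (Bp a a) (Bp a e) (Bp e e)
/-- Second coefficient of the binary cubic. -/
def cQ (a e f : Fin 3 → ℂ) : ℂ :=
  det3 (Bp a a) (Bp a f) (Bp e e) + 2 * det3 (Bp a a) (Bp a e) (Bp e f)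

theorem Cub_expand (a e f : Fin 3 → ℂ) (y z : ℂ) :
    Cub a (y • e + z • f) = cP a e * y ^ 3 + cQ a e f * y ^ 2 * z + cQ a f e * y * z ^ 2
      + cP a f * z ^ 3 := by
  simp only [Cub, cP, cQ, Bp_add_left, Bp_add_right, Bp_smul_left, Bp_smul_right, Bp_comm f e]
  generalize Bp a a = A
  generalize Bp a e = A1
  generalize Bp a f = A2
  generalize Bp e e = A3
  generalize Bp e f = A4
  generalize Bp f f = A5
  simp only [det3, Pi.add_apply, Pi.smul_apply, smul_eq_mul]
  ring

theorem Cub_shift (a v : Fin 3 → ℂ) (x : ℂ) : Cub a (x • a + v) = Cub a v := by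
  simp only [Cub, Bp_add_left, Bp_add_right, Bp_smul_left, Bp_smul_right, Bp_comm v a]
  generalize Bp a a = A
  generalize Bp a v = A1
  generalize Bp v v = A2
  simp only [det3, Pi.add_apply, Pi.smul_apply, smul_eq_mul]
  ring

theorem Cub_of_prop (a v : Fin 3 → ℂ) (k : ℂ) (h : Bp v v = k • Bp a a) : Cub a v = 0 := by
  rw [Cub, h]
  simp only [det3, Pi.smul_apply, smul_eq_mul]
  ring

theorem exists_frame (a : Fin 3 → ℂ) (ha : a ≠ 0) :
    ∃ e f : Fin 3 → ℂ, det3 a e f ≠ 0 ∧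
      dsc (cP a e) (cQ a e f) (cQ a f e) (cP a f) = -(27 / 16) * gTwo a * det3 a e f ^ 6 := by
  by_cases h0 : a 0 = 0
  · by_cases h1 : a 1 = 0
    · by_cases h2 : a 2 = 0
      · exact absurd (ext3 h0 h1 h2) ha
      · refine ⟨![1, 0, 0], ![0, 1, 0], ?_, ?_⟩
        · simpa [det3] using h2
        · simp [dsc, cP, cQ, det3, Bp0, Bp1, Bp2, gTwo, h0, h1]
    · refine ⟨![0, 0, 1], ![1, 0, 0], ?_, ?_⟩
      · simpa [det3] using h1
      · simp [dsc, cP, cQ, det3, Bp0, Bp1, Bp2, gTwo, h0]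
        ring
  · refine ⟨![0, 1, 0], ![0, 0, 1], ?_, ?_⟩
    · simpa [det3] using h0
    · simp [dsc, cP, cQ, det3, Bp0, Bp1, Bp2, gTwo]
      ring

/-- Value of a binary cubic. -/
def bc (p q r w y z : ℂ) : ℂ := p * y ^ 3 + q * y ^ 2 * z + r * y * z ^ 2 + w * z ^ 3

theorem dsc_ne_zero (p q r w y z y' z' : ℂ) (h1 : bc p q r w y z = 0)
    (h2 : bc p q r w y' z' = 0) (h3 : bc p q r w (y + y') (z + z') = 0)
    (h4 : bc p q r w (y - y') (z - z') ≠ 0) : dsc p q r w ≠ 0 := by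
  intro h0
  obtain ⟨Q, hQ⟩ : ∃ Q, Q = 3 * p * y ^ 2 * y' + q * (y ^ 2 * z' + 2 * y * y' * z)
    + r * (y' * z ^ 2 + 2 * y * z * z') + 3 * w * z ^ 2 * z' := ⟨_, rfl⟩
  obtain ⟨R, hR⟩ : ∃ R, R = 3 * p * y' ^ 2 * y + q * (y' ^ 2 * z + 2 * y * y' * z')
    + r * (y * z' ^ 2 + 2 * y' * z * z') + 3 * w * z' ^ 2 * z := ⟨_, rfl⟩
  have hcov : dsc (bc p q r w y z) Q R (bc p q r w y' z') =
      (y * z' - y' * z) ^ 6 * dsc p q r w := by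
    rw [hQ, hR]; simp only [dsc, bc]; ring
  have hs : Q + R = 0 := by
    rw [hQ, hR]; simp only [bc] at h1 h2 h3; linear_combination h3 - h1 - h2
  have hd : bc p q r w (y - y') (z - z') = R - Q := by
    rw [hQ, hR]; simp only [bc] at h1 h2 h3 ⊢; linear_combination h1 - h2
  rw [h1, h2, h0] at hcov
  have hR2 : R = -Q := by linear_combination hs
  have : Q ^ 4 = 0 := by
    simp only [dsc] at hcov; rw [hR2] at hcov; linear_combination hcov
  have hQ0 : Q = 0 := by simpa using this
  apply h4; rw [hd, hR2, hQ0]; ring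

/-- Geometric core, first direction. -/
theorem core_one (a u v : Fin 3 → ℂ) (k l m : ℂ) (hd : det3 a u v ≠ 0)
    (hu : Bp u u = k • Bp a a) (hv : Bp v v = l • Bp a a)
    (hw : Bp (a + u + v) (a + u + v) = m • Bp a a) : gOne a ≠ 0 ∧ gTwo a ≠ 0 := by
  have huv : Bp u v = ((m - 1 - k - l) / 2) • Bp a a - Bp a u - Bp a v := by
    simp only [Bp_add_left, Bp_add_right, hu, hv, Bp_comm u a, Bp_comm v a, Bp_comm v u] at hw
    apply ext3
    · have := congrFun hw 0
      simp only [Pi.add_apply, Pi.sub_apply, Pi.smul_apply, smul_eq_mul] at this ⊢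
      linear_combination this / 2
    · have := congrFun hw 1
      simp only [Pi.add_apply, Pi.sub_apply, Pi.smul_apply, smul_eq_mul] at this ⊢
      linear_combination this / 2
    · have := congrFun hw 2
      simp only [Pi.add_apply, Pi.sub_apply, Pi.smul_apply, smul_eq_mul] at this ⊢
      linear_combination this / 2
  have hJ : det3 (Bp a a) (Bp a u) (Bp a v) ≠ 0 := by
    intro hJ
    obtain ⟨n, hn, n1, n2, n3⟩ := exists_kernel hJ
    have n4 : Bp u v 0 * n 0 + Bp u v 1 * n 1 + Bp u v 2 * n 2 = 0 := by
      rw [huv]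
      simp only [Pi.sub_apply, Pi.smul_apply, smul_eq_mul]
      linear_combination ((m - 1 - k - l) / 2) * n1 - n2 - n3
    have key : ∀ w : Fin 3 → ℂ, Bp w w 0 * n 0 + Bp w w 1 * n 1 + Bp w w 2 * n 2 = 0 := by
      intro w
      obtain ⟨x, y, z, rfl⟩ := cramer' a u v w hd
      simp only [Bp_add_left, Bp_add_right, Bp_smul_left, Bp_smul_right, hu, hv, Bp_comm u a,
        Bp_comm v a, Bp_comm v u]
      simp only [Pi.add_apply, Pi.smul_apply, smul_eq_mul]
      linear_combination (x ^ 2 + y ^ 2 * k + z ^ 2 * l) * n1 + 2 * x * y * n2 + 2 * x * z * n3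
        + 2 * y * z * n4
    have k1 := key ![1, 0, 0]
    have k2 := key ![0, 1, 0]
    have k3 := key ![1, 1, 0]
    simp [Bp0, Bp1, Bp2] at k1 k2 k3
    apply hn
    refine ext3 ?_ k1 k2
    simpa [k1, k2] using k3
  refine ⟨fun h => hJ (by rw [jac, h]; ring), fun h => ?_⟩
  have ha : a ≠ 0 := by rintro rfl; apply hd; simp [det3]
  obtain ⟨e, f, hef, hdsc⟩ := exists_frame a ha
  rw [h, mul_zero, zero_mul] at hdsc
  obtain ⟨x, y, z, hu'⟩ := cramer' a e f u hef
  obtain ⟨x', y', z', hv'⟩ := cramer' a e f v hef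
  have ev : ∀ y z : ℂ, bc (cP a e) (cQ a e f) (cQ a f e) (cP a f) y z = Cub a (y • e + z • f) := by
    intro y z; rw [Cub_expand]; rfl
  refine dsc_ne_zero _ _ _ _ y z y' z' ?_ ?_ ?_ ?_ hdsc
  · rw [ev, ← Cub_shift a _ x, ← add_assoc, ← hu']
    exact Cub_of_prop _ _ _ hu
  · rw [ev, ← Cub_shift a _ x', ← add_assoc, ← hv']
    exact Cub_of_prop _ _ _ hv
  · rw [ev, ← Cub_shift a _ (1 + x + x')]
    have : (1 + x + x') • a + ((y + y') • e + (z + z') • f) = a + u + v := by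
      rw [hu', hv']; module
    rw [this]
    exact Cub_of_prop _ _ _ hw
  · rw [ev, ← Cub_shift a _ (x - x')]
    have : (x - x') • a + ((y - y') • e + (z - z') • f) = u + (-1 : ℂ) • v := by
      rw [hu', hv']; module
    rw [this]
    have h4 : Cub a (u + (-1 : ℂ) • v) = 4 * det3 (Bp a a) (Bp a u) (Bp a v) := by
      simp only [Cub, Bp_add_left, Bp_add_right, Bp_smul_left, Bp_smul_right, Bp_comm v u,
        huv, hu, hv]
      generalize Bp a a = A
      generalize Bp a v = A1
      generalize Bp a u = A2
      simp only [det3, Pi.add_apply, Pi.sub_apply, Pi.smul_apply, smul_eq_mul]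
      ring
    rw [h4]
    exact mul_ne_zero (by norm_num) hJ

theorem quad_factor (p q r : ℂ) : ∃ s t s' t' : ℂ, ∀ y z : ℂ,
    p * y ^ 2 + q * y * z + r * z ^ 2 = (s * y + t * z) * (s' * y + t' * z) := by
  by_cases hp : p = 0
  · exact ⟨0, 1, q, r, fun y z => by rw [hp]; ring⟩
  · obtain ⟨d, hd⟩ := IsAlgClosed.exists_pow_nat_eq (q ^ 2 - 4 * p * r) (n := 2) (by norm_num)
    refine ⟨p, (q + d) / 2, 1, (q - d) / (2 * p), fun y z => ?_⟩
    field_simp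
    linear_combination (z ^ 2) * hd

theorem cub_factor (p q r w : ℂ) : ∃ s t s' t' s'' t'' : ℂ, ∀ y z : ℂ,
    bc p q r w y z = (s * y + t * z) * (s' * y + t' * z) * (s'' * y + t'' * z) := by
  by_cases hp : p = 0
  · obtain ⟨s, t, s', t', h⟩ := quad_factor q r w
    refine ⟨0, 1, s, t, s', t', fun y z => ?_⟩
    rw [mul_assoc, ← h, bc, hp]; ring
  · obtain ⟨x, hx⟩ : ∃ x : ℂ, p * x ^ 3 + q * x ^ 2 + r * x + w = 0 := by
      have hdeg : (Polynomial.C p * Polynomial.X ^ 3 + Polynomial.C q * Polynomial.X ^ 2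
        + Polynomial.C r * Polynomial.X + Polynomial.C w).degree = 3 :=
        Polynomial.degree_cubic hp
      obtain ⟨x, hx⟩ := IsAlgClosed.exists_root _ (by rw [hdeg]; decide)
      exact ⟨x, by simpa [Polynomial.IsRoot] using hx⟩
    obtain ⟨s, t, s', t', h⟩ := quad_factor p (q + p * x) (r + q * x + p * x ^ 2)
    refine ⟨1, -x, s, t, s', t', fun y z => ?_⟩
    rw [mul_assoc, ← h, bc]; linear_combination z ^ 3 * hx

theorem cub_roots (p q r w : ℂ) (h : dsc p q r w ≠ 0) : ∃ s t s' t' s'' t'' : ℂ,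
    bc p q r w s t = 0 ∧ bc p q r w s' t' = 0 ∧ bc p q r w s'' t'' = 0 ∧
    s * t' - t * s' ≠ 0 ∧ s * t'' - t * s'' ≠ 0 ∧ s' * t'' - t' * s'' ≠ 0 := by
  obtain ⟨s, t, s', t', s'', t'', H⟩ := cub_factor p q r w
  have hp : p = s * s' * s'' := by
    have := H 1 0; simp only [bc] at this; linear_combination this
  have hw : w = t * t' * t'' := by
    have := H 0 1; simp only [bc] at this; linear_combination this
  have hq : q = s * s' * t'' + s * t' * s'' + t * s' * s'' := by
    have h1 := H 1 1; have h2 := H 1 (-1)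
    simp only [bc] at h1 h2; linear_combination (h1 - h2) / 2 - hw
  have hr : r = t * t' * s'' + t * s' * t'' + s * t' * t'' := by
    have h1 := H 1 1; have h2 := H 1 (-1)
    simp only [bc] at h1 h2; linear_combination (h1 + h2) / 2 - hp
  have hD : dsc p q r w = (s * t' - t * s') ^ 2 * (s * t'' - t * s'') ^ 2
      * (s' * t'' - t' * s'') ^ 2 := by
    rw [hp, hq, hr, hw]; simp only [dsc]; ring
  rw [hD] at h
  refine ⟨t, -s, t', -s', t'', -s'', ?_, ?_, ?_, ?_, ?_, ?_⟩
  · rw [H]; ring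
  · rw [H]; ring
  · rw [H]; ring
  · intro h0; apply h
    have : s * t' - t * s' = 0 := by linear_combination h0
    rw [this]; ring
  · intro h0; apply h
    have : s * t'' - t * s'' = 0 := by linear_combination h0
    rw [this]; ring
  · intro h0; apply h
    have : s' * t'' - t' * s'' = 0 := by linear_combination h0
    rw [this]; ring

theorem lift_root (a v v' : Fin 3 → ℂ) (h1 : gOne a ≠ 0) (hd : det3 a v v' ≠ 0)
    (hC : Cub a v = 0) : ∃ x k : ℂ, Bp (x • a + v) (x • a + v) = k • Bp a a := by
  have hJ : det3 (Bp a a) (Bp a v) (Bp a v') ≠ 0 := by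
    rw [jac]; exact mul_ne_zero (mul_ne_zero (by norm_num) h1) hd
  have hc := cramer (Bp a a) (Bp a v) (Bp a v') (Bp v v)
  rw [show det3 (Bp a a) (Bp a v) (Bp v v) = 0 from hC, zero_smul, add_zero] at hc
  generalize det3 (Bp a a) (Bp a v) (Bp a v') = J at hJ hc
  generalize det3 (Bp v v) (Bp a v) (Bp a v') = K at hc
  generalize det3 (Bp a a) (Bp v v) (Bp a v') = M at hc
  have hvv : Bp v v = (K / J) • Bp a a + (M / J) • Bp a v := by
    have : Bp v v = J⁻¹ • (J • Bp v v) := by rw [smul_smul, inv_mul_cancel₀ hJ, one_smul]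
    rw [this, hc]
    simp only [smul_add, smul_smul, div_eq_inv_mul]
  refine ⟨-(M / J) / 2, K / J + (M / J) ^ 2 / 4 - (M / J) ^ 2 / 2 + (M / J) ^ 2 / 2, ?_⟩
  simp only [Bp_add_left, Bp_add_right, Bp_smul_left, Bp_smul_right, Bp_comm v a, hvv]
  module

/-- Geometric core, second direction. -/
theorem core_two (a : Fin 3 → ℂ) (ha : a ≠ 0) (h1 : gOne a ≠ 0) (h2 : gTwo a ≠ 0) :
    ∃ (u v w : Fin 3 → ℂ) (k l m : ℂ), Bp u u = k • Bp a a ∧ Bp v v = l • Bp a a ∧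
      Bp w w = m • Bp a a ∧ det3 a u v ≠ 0 ∧ det3 a u w ≠ 0 ∧ det3 a v w ≠ 0 := by
  obtain ⟨e, f, hef, hdsc⟩ := exists_frame a ha
  have hD : dsc (cP a e) (cQ a e f) (cQ a f e) (cP a f) ≠ 0 := by
    rw [hdsc]
    exact mul_ne_zero (mul_ne_zero (by norm_num) h2) (pow_ne_zero _ hef)
  obtain ⟨s, t, s', t', s'', t'', r1, r2, r3, d1, d2, d3⟩ := cub_roots _ _ _ _ hD
  have ev : ∀ y z : ℂ, bc (cP a e) (cQ a e f) (cQ a f e) (cP a f) y z = Cub a (y • e + z • f) := by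
    intro y z; rw [Cub_expand]; rfl
  rw [ev] at r1 r2 r3
  have dd : ∀ x s t x' s' t' : ℂ, det3 a (x • a + (s • e + t • f)) (x' • a + (s' • e + t' • f)) =
      (s * t' - t * s') * det3 a e f := by
    intro x s t x' s' t'
    simp only [det3, Pi.add_apply, Pi.smul_apply, smul_eq_mul]
    ring
  have dd0 : ∀ s t s' t' : ℂ, det3 a (s • e + t • f) (s' • e + t' • f) =
      (s * t' - t * s') * det3 a e f := by
    intro s t s' t'
    simp only [det3, Pi.add_apply, Pi.smul_apply, smul_eq_mul]
    ring
  obtain ⟨x, k, hu⟩ := lift_root a (s • e + t • f) (s' • e + t' • f) h1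
    (by rw [dd0]; exact mul_ne_zero d1 hef) r1
  obtain ⟨x', l, hv⟩ := lift_root a (s' • e + t' • f) (s'' • e + t'' • f) h1
    (by rw [dd0]; exact mul_ne_zero d3 hef) r2
  obtain ⟨x'', m, hw⟩ := lift_root a (s'' • e + t'' • f) (s' • e + t' • f) h1
    (by rw [dd0]; exact mul_ne_zero (fun h => d3 (by linear_combination -h)) hef) r3
  refine ⟨_, _, _, k, l, m, hu, hv, hw, ?_, ?_, ?_⟩
  · rw [dd]; exact mul_ne_zero d1 hef
  · rw [dd]; exact mul_ne_zero d2 hef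
  · rw [dd]; exact mul_ne_zero d3 hef

/-- Pointwise form of `F = ∑ cⱼ Lⱼ³`. -/
def Dec (c₁ c₂ c₃ c₄ : ℂ) (p q r s : Fin 3 → ℂ) : Prop :=
  ∀ x y z : ℂ, y ^ 2 * z - x ^ 3 - x * z ^ 2 =
    c₁ * (p 0 * x + p 1 * y + p 2 * z) ^ 3 + c₂ * (q 0 * x + q 1 * y + q 2 * z) ^ 3
    + c₃ * (r 0 * x + r 1 * y + r 2 * z) ^ 3 + c₄ * (s 0 * x + s 1 * y + s 2 * z) ^ 3

/-- A moment of the weighted points. -/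
def mom (c₁ c₂ c₃ c₄ : ℂ) (p q r s : Fin 3 → ℂ) (i j k : Fin 3) : ℂ :=
  c₁ * (p i * p j * p k) + c₂ * (q i * q j * q k) + c₃ * (r i * r j * r k)
    + c₄ * (s i * s j * s k)

theorem Dec.moments {c₁ c₂ c₃ c₄ : ℂ} {p q r s : Fin 3 → ℂ} (h : Dec c₁ c₂ c₃ c₄ p q r s) :
    mom c₁ c₂ c₃ c₄ p q r s 0 0 0 = -1 ∧ mom c₁ c₂ c₃ c₄ p q r s 1 1 1 = 0 ∧
    mom c₁ c₂ c₃ c₄ p q r s 2 2 2 = 0 ∧ mom c₁ c₂ c₃ c₄ p q r s 0 0 1 = 0 ∧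
    mom c₁ c₂ c₃ c₄ p q r s 0 1 1 = 0 ∧ mom c₁ c₂ c₃ c₄ p q r s 0 0 2 = 0 ∧
    mom c₁ c₂ c₃ c₄ p q r s 0 2 2 = -1 / 3 ∧ mom c₁ c₂ c₃ c₄ p q r s 1 1 2 = 1 / 3 ∧
    mom c₁ c₂ c₃ c₄ p q r s 1 2 2 = 0 ∧ mom c₁ c₂ c₃ c₄ p q r s 0 1 2 = 0 := by
  have hx := h 1 0 0
  have hy := h 0 1 0
  have hz := h 0 0 1
  have hxy := h 1 1 0
  have hxy' := h 1 (-1) 0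
  have hxz := h 1 0 1
  have hxz' := h 1 0 (-1)
  have hyz := h 0 1 1
  have hyz' := h 0 1 (-1)
  have hxyz := h 1 1 1
  simp only [mom]
  refine ⟨?_, ?_, ?_, ?_, ?_, ?_, ?_, ?_, ?_, ?_⟩
  · linear_combination -hx
  · linear_combination -hy
  · linear_combination -hz
  · linear_combination -(hxy - hxy') / 6 + hy / 3
  · linear_combination -(hxy + hxy') / 6 + hx / 3
  · linear_combination -(hxz - hxz') / 6 + hz / 3
  · linear_combination -(hxz + hxz') / 6 + hx / 3
  · linear_combination -(hyz - hyz') / 6 + hz / 3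
  · linear_combination -(hyz + hyz') / 6 + hy / 3
  · linear_combination -(hxyz - hxy - hxz - hyz + hx + hy + hz) / 6

theorem Dec.det_ne_zero {c₁ c₂ c₃ c₄ : ℂ} {p q r s : Fin 3 → ℂ} (h : Dec c₁ c₂ c₃ c₄ p q r s) :
    det3 p q r ≠ 0 := by
  intro hd
  obtain ⟨m, hm, h1, h2, h3⟩ := exists_kernel hd
  obtain ⟨m000, m111, m222, m001, m011, m002, m022, m112, m122, m012⟩ := h.moments
  simp only [mom] at *
  obtain ⟨d, hdd⟩ : ∃ d, d = c₄ * (s 0 * m 0 + s 1 * m 1 + s 2 * m 2) := ⟨_, rfl⟩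
  have n00 : d * s 0 ^ 2 = -m 0 := by
    rw [hdd]
    linear_combination m 0 * m000 + m 1 * m001 + m 2 * m002 - c₁ * p 0 ^ 2 * h1
      - c₂ * q 0 ^ 2 * h2 - c₃ * r 0 ^ 2 * h3
  have n11 : d * s 1 ^ 2 = m 2 / 3 := by
    rw [hdd]
    linear_combination m 0 * m011 + m 1 * m111 + m 2 * m112 - c₁ * p 1 ^ 2 * h1
      - c₂ * q 1 ^ 2 * h2 - c₃ * r 1 ^ 2 * h3
  have n22 : d * s 2 ^ 2 = -m 0 / 3 := by
    rw [hdd]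
    linear_combination m 0 * m022 + m 1 * m122 + m 2 * m222 - c₁ * p 2 ^ 2 * h1
      - c₂ * q 2 ^ 2 * h2 - c₃ * r 2 ^ 2 * h3
  have n01 : d * (s 0 * s 1) = 0 := by
    rw [hdd]
    linear_combination m 0 * m001 + m 1 * m011 + m 2 * m012 - c₁ * (p 0 * p 1) * h1
      - c₂ * (q 0 * q 1) * h2 - c₃ * (r 0 * r 1) * h3
  have n02 : d * (s 0 * s 2) = -m 2 / 3 := by
    rw [hdd]
    linear_combination m 0 * m002 + m 1 * m012 + m 2 * m022 - c₁ * (p 0 * p 2) * h1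
      - c₂ * (q 0 * q 2) * h2 - c₃ * (r 0 * r 2) * h3
  have n12 : d * (s 1 * s 2) = m 1 / 3 := by
    rw [hdd]
    linear_combination m 0 * m012 + m 1 * m112 + m 2 * m122 - c₁ * (p 1 * p 2) * h1
      - c₂ * (q 1 * q 2) * h2 - c₃ * (r 1 * r 2) * h3
  have e1 : m 0 * m 2 = 0 := by
    linear_combination 3 * (d * s 1 ^ 2 * n00 - m 0 * n11 - d * (s 0 * s 1) * n01)
  have e2 : m 0 * m 1 = 0 := by
    linear_combination 3 * (d * (s 1 * s 2) * n00 - m 0 * n12 - d * (s 0 * s 2) * n01)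
  have e3 : m 0 ^ 2 * 3 = m 2 ^ 2 := by
    linear_combination 9 * (d * (s 0 * s 2) * n02 - m 2 / 3 * n02 - d * s 2 ^ 2 * n00 + m 0 * n22)
  have e4 : m 1 ^ 2 = - (m 0 * m 2) := by
    linear_combination 9 * (d * s 2 ^ 2 * n11 + m 2 / 3 * n22 - d * (s 1 * s 2) * n12
      - m 1 / 3 * n12)
  apply hm
  have h0 : m 0 = 0 := by
    rcases mul_eq_zero.1 e1 with e | e
    · exact e
    · rw [e] at e3
      simpa using e3
  rw [h0] at e3 e4
  have h2' : m 2 = 0 := by simpa using e3.symm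
  have h1' : m 1 = 0 := by simpa using e4
  exact ext3 h0 h1' h2'

theorem Dec.c_ne_zero {c₁ c₂ c₃ c₄ : ℂ} {p q r s : Fin 3 → ℂ} (h : Dec c₁ c₂ c₃ c₄ p q r s) :
    c₁ ≠ 0 := by
  rintro rfl
  have : Dec 0 c₂ c₃ c₄ 0 q r s := by
    intro x y z; rw [h x y z]; ring
  exact this.det_ne_zero (by simp [det3])

theorem Dec.prop {c₁ c₂ c₃ c₄ : ℂ} {p q r s : Fin 3 → ℂ} (h : Dec c₁ c₂ c₃ c₄ p q r s) :
    c₁ • det3 p q r • Bp p p + c₄ • det3 s q r • Bp s s = 0 := by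
  obtain ⟨m000, m111, m222, m001, m011, m002, m022, m112, m122, m012⟩ := h.moments
  simp only [mom] at *
  apply ext3 <;>
    simp only [Bp0, Bp1, Bp2, Pi.add_apply, Pi.smul_apply, smul_eq_mul, Pi.zero_apply, det3]
  · linear_combination (q 1 * r 2 - q 2 * r 1) * m001 - (q 0 * r 2 - q 2 * r 0) * m011
      + (q 0 * r 1 - q 1 * r 0) * m012
  · linear_combination (q 1 * r 2 - q 2 * r 1) * (m000 - 3 * m022)
      - (q 0 * r 2 - q 2 * r 0) * (m001 - 3 * m122)
      + (q 0 * r 1 - q 1 * r 0) * (m002 - 3 * m222)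
  · linear_combination (q 1 * r 2 - q 2 * r 1) * (m011 + m002)
      - (q 0 * r 2 - q 2 * r 0) * (m111 + m012)
      + (q 0 * r 1 - q 1 * r 0) * (m112 + m022)

theorem Dec.prop' {c₁ c₂ c₃ c₄ : ℂ} {p q r s : Fin 3 → ℂ} (h : Dec c₁ c₂ c₃ c₄ p q r s) :
    ∃ k : ℂ, Bp s s = k • Bp p p := by
  have h' : Dec c₄ c₂ c₃ c₁ s q r p := by intro x y z; rw [h x y z]; ring
  have e := h.prop
  have h1 := h'.c_ne_zero
  have h2 := h'.det_ne_zero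
  rw [smul_smul, smul_smul] at e
  have h3 := mul_ne_zero h1 h2
  refine ⟨-((c₄ * det3 s q r)⁻¹ * (c₁ * det3 p q r)), ?_⟩
  have e2 : (c₄ * det3 s q r) • Bp s s = -((c₁ * det3 p q r) • Bp p p) :=
    eq_neg_of_add_eq_zero_right e
  have : Bp s s = (c₄ * det3 s q r)⁻¹ • ((c₄ * det3 s q r) • Bp s s) := by
    rw [smul_smul, inv_mul_cancel₀ h3, one_smul]
  rw [this, e2]
  module

theorem Dec.good {c₁ c₂ c₃ c₄ : ℂ} {p q r s : Fin 3 → ℂ} (h : Dec c₁ c₂ c₃ c₄ p q r s) :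
    gOne p ≠ 0 ∧ gTwo p ≠ 0 := by
  obtain ⟨m, hm⟩ := h.prop'
  have hq : Dec c₁ c₃ c₄ c₂ p r s q := by intro x y z; rw [h x y z]; ring
  have hr : Dec c₁ c₂ c₄ c₃ p q s r := by intro x y z; rw [h x y z]; ring
  have hs : Dec c₄ c₂ c₃ c₁ s q r p := by intro x y z; rw [h x y z]; ring
  obtain ⟨k, hk⟩ := hq.prop'
  obtain ⟨l, hl⟩ := hr.prop'
  have d0 := h.det_ne_zero
  have d1 := hs.det_ne_zero
  have d2 : det3 p s r ≠ 0 := by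
    intro h0; apply hq.det_ne_zero; rw [← neg_eq_zero, ← h0]; simp only [det3]; ring
  have d3 := hr.det_ne_zero
  have hc := cramer p q r s
  generalize hA : det3 s q r = A at d1 hc
  generalize hB : det3 p s r = B at d2 hc
  generalize hC : det3 p q s = C at d3 hc
  have hsum : p + (B / A) • q + (C / A) • r = (det3 p q r / A) • s := by
    have : p + (B / A) • q + (C / A) • r = A⁻¹ • (A • p + B • q + C • r) := by
      simp only [smul_add, smul_smul, inv_mul_cancel₀ d1, one_smul, div_eq_inv_mul]
    rw [this, ← hc, smul_smul, div_eq_inv_mul]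
  refine core_one p ((B / A) • q) ((C / A) • r) ((B / A) ^ 2 * k) ((C / A) ^ 2 * l)
    ((det3 p q r / A) ^ 2 * m) ?_ ?_ ?_ ?_
  · have : det3 p ((B / A) • q) ((C / A) • r) = (B / A) * (C / A) * det3 p q r := by
      simp only [det3, Pi.smul_apply, smul_eq_mul]; ring
    rw [this]
    exact mul_ne_zero (mul_ne_zero (div_ne_zero d2 d1) (div_ne_zero d3 d1)) d0
  · rw [Bp_smul_left, Bp_smul_right, hk]; module
  · rw [Bp_smul_left, Bp_smul_right, hl]; module
  · rw [hsum, Bp_smul_left, Bp_smul_right, hm]; module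

theorem exists_Dec (a : Fin 3 → ℂ) (ha : a ≠ 0) (h1 : gOne a ≠ 0) (h2 : gTwo a ≠ 0) :
    ∃ (c₁ c₂ c₃ c₄ : ℂ) (u v w : Fin 3 → ℂ), Dec c₁ c₂ c₃ c₄ a u v w := by
  obtain ⟨u, v, w, k, l, m, hu, hv, hw, d1, d2, d3⟩ := core_two a ha h1 h2
  have hk : k ≠ 0 := by
    rintro rfl
    rw [zero_smul] at hu
    apply d1; rw [Bp_self_eq_zero hu]; simp [det3]
  have hl : l ≠ 0 := by
    rintro rfl
    rw [zero_smul] at hv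
    apply d1; rw [Bp_self_eq_zero hv]; simp [det3]
  have hm : m ≠ 0 := by
    rintro rfl
    rw [zero_smul] at hw
    apply d2; rw [Bp_self_eq_zero hw]; simp [det3]
  obtain ⟨c₁, e1⟩ : ∃ c, c = det3 w u v := ⟨_, rfl⟩
  obtain ⟨c₂, e2⟩ : ∃ c, c = det3 a w v / k := ⟨_, rfl⟩
  obtain ⟨c₃, e3⟩ : ∃ c, c = det3 a u w / l := ⟨_, rfl⟩
  obtain ⟨c₄, e4⟩ : ∃ c, c = -det3 a u v / m := ⟨_, rfl⟩
  have rel : ∀ i j : Fin 3, c₁ * (Bp a a i * a j) + c₂ * (Bp u u i * u j)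
      + c₃ * (Bp v v i * v j) + c₄ * (Bp w w i * w j) = 0 := by
    intro i j
    have hc := congrFun (cramer a u v w) j
    simp only [Pi.add_apply, Pi.smul_apply, smul_eq_mul] at hc
    rw [hu, hv, hw, e1, e2, e3, e4]
    simp only [Pi.smul_apply, smul_eq_mul]
    field_simp
    linear_combination (-Bp a a i) * hc
  have r00 := rel 0 0
  have r01 := rel 0 1
  have r02 := rel 0 2
  have r10 := rel 1 0
  have r11 := rel 1 1
  have r12 := rel 1 2
  have r20 := rel 2 0
  have r21 := rel 2 1
  have r22 := rel 2 2
  simp only [Bp0, Bp1, Bp2] at r00 r01 r02 r10 r11 r12 r20 r21 r22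
  obtain ⟨κ, hκ⟩ : ∃ κ, κ = -mom c₁ c₂ c₃ c₄ a u v w 0 0 0 := ⟨_, rfl⟩
  simp only [mom] at hκ
  have m001 : mom c₁ c₂ c₃ c₄ a u v w 0 0 1 = 0 := by
    simp only [mom]; linear_combination r00
  have m011 : mom c₁ c₂ c₃ c₄ a u v w 0 1 1 = 0 := by
    simp only [mom]; linear_combination r01
  have m012 : mom c₁ c₂ c₃ c₄ a u v w 0 1 2 = 0 := by
    simp only [mom]; linear_combination r02
  simp only [mom] at m001 m011 m012
  have m122 : mom c₁ c₂ c₃ c₄ a u v w 1 2 2 = 0 := by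
    simp only [mom]; linear_combination (m001 - r11) / 3
  have m002 : mom c₁ c₂ c₃ c₄ a u v w 0 0 2 = 0 := by
    simp only [mom]; linear_combination r20 - m011
  have m111 : mom c₁ c₂ c₃ c₄ a u v w 1 1 1 = 0 := by
    simp only [mom]; linear_combination r21 - m012
  simp only [mom] at m002 m111 m122
  have m222 : mom c₁ c₂ c₃ c₄ a u v w 2 2 2 = 0 := by
    simp only [mom]; linear_combination (m002 - r12) / 3
  have m022 : mom c₁ c₂ c₃ c₄ a u v w 0 2 2 = -κ / 3 := by
    simp only [mom]; linear_combination -r10 / 3 + hκ / 3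
  simp only [mom] at m222 m022
  have m112 : mom c₁ c₂ c₃ c₄ a u v w 1 1 2 = κ / 3 := by
    simp only [mom]; linear_combination r22 - m022
  simp only [mom] at m112
  have big : ∀ x y z : ℂ, κ * (y ^ 2 * z - x ^ 3 - x * z ^ 2) =
    c₁ * (a 0 * x + a 1 * y + a 2 * z) ^ 3 + c₂ * (u 0 * x + u 1 * y + u 2 * z) ^ 3
    + c₃ * (v 0 * x + v 1 * y + v 2 * z) ^ 3 + c₄ * (w 0 * x + w 1 * y + w 2 * z) ^ 3 := by
    intro x y z
    linear_combination (-x ^ 3) * hκ - 3 * x ^ 2 * y * m001 - 3 * x * y ^ 2 * m011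
      - 6 * x * y * z * m012 - 3 * y * z ^ 2 * m122 - 3 * x ^ 2 * z * m002 - y ^ 3 * m111
      - z ^ 3 * m222 - 3 * x * z ^ 2 * m022 - 3 * y ^ 2 * z * m112
  have hκ0 : κ ≠ 0 := by
    intro h0
    rw [h0] at hκ m022 m112
    have gen : ∀ α β : Fin 3 → ℂ,
        c₁ * ((α 0 * a 0 + α 1 * a 1 + α 2 * a 2) * (β 0 * a 0 + β 1 * a 1 + β 2 * a 2) ^ 2)
        + c₂ * ((α 0 * u 0 + α 1 * u 1 + α 2 * u 2) * (β 0 * u 0 + β 1 * u 1 + β 2 * u 2) ^ 2)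
        + c₃ * ((α 0 * v 0 + α 1 * v 1 + α 2 * v 2) * (β 0 * v 0 + β 1 * v 1 + β 2 * v 2) ^ 2)
        + c₄ * ((α 0 * w 0 + α 1 * w 1 + α 2 * w 2) * (β 0 * w 0 + β 1 * w 1 + β 2 * w 2) ^ 2)
        = 0 := by
      intro α β
      linear_combination (α 0 * β 0 ^ 2) * hκ
        + (α 1 * β 0 ^ 2 + 2 * α 0 * β 0 * β 1) * m001
        + (α 0 * β 1 ^ 2 + 2 * α 1 * β 0 * β 1) * m011
        + (2 * α 0 * β 1 * β 2 + 2 * α 1 * β 0 * β 2 + 2 * α 2 * β 0 * β 1) * m012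
        + (α 1 * β 2 ^ 2 + 2 * α 2 * β 1 * β 2) * m122
        + (α 2 * β 0 ^ 2 + 2 * α 0 * β 0 * β 2) * m002
        + (α 1 * β 1 ^ 2) * m111 + (α 2 * β 2 ^ 2) * m222
        + (α 0 * β 2 ^ 2 + 2 * α 2 * β 0 * β 2) * m022
        + (α 2 * β 1 ^ 2 + 2 * α 1 * β 1 * β 2) * m112
    have g := gen ![a 1 * u 2 - a 2 * u 1, a 2 * u 0 - a 0 * u 2, a 0 * u 1 - a 1 * u 0]
      ![a 1 * v 2 - a 2 * v 1, a 2 * v 0 - a 0 * v 2, a 0 * v 1 - a 1 * v 0]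
    simp only [Matrix.cons_val] at g
    have : c₄ * (det3 a u w * det3 a v w ^ 2) = 0 := by
      rw [← g]; simp only [det3]; ring
    have hc4 : c₄ ≠ 0 := by
      rw [e4]; exact div_ne_zero (neg_ne_zero.2 d1) hm
    exact mul_ne_zero hc4 (mul_ne_zero d2 (pow_ne_zero _ d3)) this
  refine ⟨c₁ / κ, c₂ / κ, c₃ / κ, c₄ / κ, u, v, w, fun x y z => ?_⟩
  have := big x y z
  field_simp
  linear_combination this

theorem Dec_iff (c : Fin 4 → ℂ) (L : Fin 4 → Fin 3 → ℂ) :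
    (X 1 ^ 2 * X 2 - X 0 ^ 3 - X 0 * X 2 ^ 2 : MvPolynomial (Fin 3) ℂ)
      = ∑ j, c j • lin (L j) ^ 3 ↔ Dec (c 0) (c 1) (c 2) (c 3) (L 0) (L 1) (L 2) (L 3) := by
  constructor
  · intro h x y z
    have := congrArg (MvPolynomial.eval ![x, y, z]) h
    simpa [lin, Fin.sum_univ_four, Fin.sum_univ_three, smul_eval] using this
  · intro h
    apply MvPolynomial.funext
    intro x
    have := h (x 0) (x 1) (x 2)
    simpa [lin, Fin.sum_univ_four, Fin.sum_univ_three, smul_eval] using this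

theorem no_three (r : ℕ) (hr : r < 4) :
    ¬ HasWaringDecomp 3 (X 1 ^ 2 * X 2 - X 0 ^ 3 - X 0 * X 2 ^ 2 : MvPolynomial (Fin 3) ℂ) r := by
  rintro ⟨L, hL⟩
  have key : ∃ p q s : Fin 3 → ℂ, Dec 1 1 1 1 0 p q s := by
    have ev : ∀ x y z : ℂ, y ^ 2 * z - x ^ 3 - x * z ^ 2 =
        ∑ j, (L j 0 * x + L j 1 * y + L j 2 * z) ^ 3 := by
      intro x y z
      have := congrArg (MvPolynomial.eval ![x, y, z]) hL
      simpa [lin, Fin.sum_univ_three] using this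
    interval_cases r
    · exact ⟨0, 0, 0, fun x y z => by rw [ev]; simp⟩
    · exact ⟨L 0, 0, 0, fun x y z => by rw [ev]; simp⟩
    · exact ⟨L 0, L 1, 0, fun x y z => by rw [ev]; simp [Fin.sum_univ_two]⟩
    · exact ⟨L 0, L 1, L 2, fun x y z => by rw [ev]; simp [Fin.sum_univ_three]⟩
  obtain ⟨p, q, s, h⟩ := key
  exact h.det_ne_zero (by simp [det3])

theorem has_four :
    HasWaringDecomp 3 (X 1 ^ 2 * X 2 - X 0 ^ 3 - X 0 * X 2 ^ 2 : MvPolynomial (Fin 3) ℂ) 4 := by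
  obtain ⟨c₁, c₂, c₃, c₄, u, v, w, h⟩ := exists_Dec ![1, 0, 1]
    (fun h => by have := congrFun h 0; simp at this)
    (by simp [gOne]; norm_num) (by simp [gTwo]; norm_num)
  have hF := (Dec_iff ![c₁, c₂, c₃, c₄] ![![1, 0, 1], u, v, w]).2 h
  have hroot : ∀ x : ℂ, ∃ y : ℂ, y ^ 3 = x := fun x =>
    IsAlgClosed.exists_pow_nat_eq x (by norm_num)
  choose ρ hρ using hroot
  refine ⟨fun j => ρ (![c₁, c₂, c₃, c₄] j) • (![![1, 0, 1], u, v, w] : Fin 4 → Fin 3 → ℂ) j, ?_⟩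
  rw [hF]
  refine Finset.sum_congr rfl fun j _ => ?_
  beta_reduce
  generalize (![c₁, c₂, c₃, c₄] : Fin 4 → ℂ) j = c
  generalize (![![1, 0, 1], u, v, w] : Fin 4 → Fin 3 → ℂ) j = M
  have : lin (ρ c • M) = C (ρ c) * lin M := by
    simp [lin, Finset.mul_sum, mul_assoc]
  rw [this, mul_pow, ← C_pow, hρ, smul_eq_C_mul]

theorem rank_eq_s9 : waringRank 3
    (X 1 ^ 2 * X 2 - X 0 ^ 3 - X 0 * X 2 ^ 2 : MvPolynomial (Fin 3) ℂ) = 4 := by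
  apply le_antisymm
  · exact Nat.sInf_le has_four
  · apply le_csInf ⟨4, has_four⟩
    intro r hr
    by_contra hlt
    exact no_three r (not_le.1 hlt) hr

/-- forbidden locus of the nodal plane cubic `F = y²z - x³ - xz²`:
`F` has Waring rank 4 and a nonzero linear form `ax + by + cz` is forbidden iff
`g₁(a,b,c) · g₂(a,b,c) = 0`, where `g₁ = X³ - 6Y²Z + 3XZ²` and
`g₂ = 9X⁴Y² - 4Y⁶ - 24XY⁴Z - 30X²Y²Z² + 4X³Z³ - 3Y²Z⁴ - 12XZ⁵`. -/
theorem forbidden_locus_nodal_cubic :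
    waringRank 3 (X 1 ^ 2 * X 2 - X 0 ^ 3 - X 0 * X 2 ^ 2 : MvPolynomial (Fin 3) ℂ) = 4 ∧
    ∀ a : Fin 3 → ℂ, a ≠ 0 →
      (¬ InWaringLocus 3 (X 1 ^ 2 * X 2 - X 0 ^ 3 - X 0 * X 2 ^ 2 : MvPolynomial (Fin 3) ℂ) a ↔
        (a 0 ^ 3 - 6 * a 1 ^ 2 * a 2 + 3 * a 0 * a 2 ^ 2) *
          (9 * a 0 ^ 4 * a 1 ^ 2 - 4 * a 1 ^ 6 - 24 * a 0 * a 1 ^ 4 * a 2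
            - 30 * a 0 ^ 2 * a 1 ^ 2 * a 2 ^ 2 + 4 * a 0 ^ 3 * a 2 ^ 3
            - 3 * a 1 ^ 2 * a 2 ^ 4 - 12 * a 0 * a 2 ^ 5) = 0) := by
  refine ⟨rank_eq_s9, fun a ha => ?_⟩
  have key : InWaringLocus 3
      (X 1 ^ 2 * X 2 - X 0 ^ 3 - X 0 * X 2 ^ 2 : MvPolynomial (Fin 3) ℂ) a ↔
      gOne a ≠ 0 ∧ gTwo a ≠ 0 := by
    unfold InWaringLocus
    rw [rank_eq_s9]
    constructor
    · rintro ⟨c, L, j, rfl, hF⟩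
      have h := (Dec_iff c L).1 hF
      fin_cases j
      · exact h.good
      · have h' : Dec (c 1) (c 0) (c 2) (c 3) (L 1) (L 0) (L 2) (L 3) := by
          intro x y z; rw [h x y z]; ring
        exact h'.good
      · have h' : Dec (c 2) (c 0) (c 1) (c 3) (L 2) (L 0) (L 1) (L 3) := by
          intro x y z; rw [h x y z]; ring
        exact h'.good
      · have h' : Dec (c 3) (c 0) (c 1) (c 2) (L 3) (L 0) (L 1) (L 2) := by
          intro x y z; rw [h x y z]; ring
        exact h'.good
    · rintro ⟨h1, h2⟩
      obtain ⟨c₁, c₂, c₃, c₄, u, v, w, h⟩ := exists_Dec a ha h1 h2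
      exact ⟨![c₁, c₂, c₃, c₄], ![a, u, v, w], 0, rfl,
        (Dec_iff ![c₁, c₂, c₃, c₄] ![a, u, v, w]).2 h⟩
  rw [key, ← not_or, not_not, ← mul_eq_zero]
  rfl

end
end

section
/- Let S = ℂ[x_{1,0},…,x_{1,n_1},…,x_{s,0},…,x_{s,n_s}] and for each i let S^{[i]} = ℂ[x_{i,0},…,x_{i,n_i}] and T^{[i]} the corresponding dual ring. Let F_i ∈ S^{[i]} be nonzero homogeneous of degree d for i = 1,…,s, and F = F_1 + ⋯ + F_s. Assume: (1) for each i there exists a linear differential operator ∂_i ∈ T^{[i]}_1 with rk(∂_i∘F_i) = rk(F_i); (2) rk(F_1 + ⋯ + F_s) = rk(F_1) + ⋯ + rk(F_s); (3) rk(∂_1∘F_1 + ⋯ + ∂_s∘F_s) = rk(∂_1∘F_1) + ⋯ + rk(∂_s∘F_s). Then the Waring locus of F is the union of the Waring loci of the F_i: a nonzero linear form L ∈ S_1 lies in W_F if and only if there is an index i such that L involves only the variables x_{i,0},…,x_{i,n_i} and L lies in W_{F_i}. -/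
open MvPolynomial

noncomputable section

section helpers

set_option linter.unusedSectionVars false

variable {σ : Type*} [Fintype σ]

lemma lin_smul (t : ℂ) (c : σ → ℂ) : lin (t • c) = t • lin c := by
  simp [lin, Finset.smul_sum, MvPolynomial.smul_eq_C_mul, mul_assoc]

lemma lin_add (b c : σ → ℂ) : lin (b + c) = lin b + lin c := by
  simp [lin, add_mul, Finset.sum_add_distrib]

lemma lin_zero : lin (0 : σ → ℂ) = 0 := by simp [lin]

lemma lin_single [DecidableEq σ] (j : σ) (t : ℂ) : lin (Pi.single j t) = t • X j := by
  unfold lin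
  rw [Finset.sum_eq_single j]
  · simp [MvPolynomial.smul_eq_C_mul]
  · intro b _ hb
    simp [hb]
  · simp

lemma lin_sum {ι : Type*} (J : Finset ι) (c : ι → σ → ℂ) :
    lin (∑ j ∈ J, c j) = ∑ j ∈ J, lin (c j) := by
  classical
  induction J using Finset.induction_on with
  | empty => simp [lin_zero]
  | insert a s ha ih => rw [Finset.sum_insert ha, Finset.sum_insert ha, lin_add, ih]

/-- substitution of linear forms -/
lemma aeval_lin (M : σ → σ → ℂ) (c : σ → ℂ) :
    aeval (fun k => lin (M k)) (lin c) = lin (∑ k, c k • M k) := by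
  rw [lin_sum]
  simp only [lin_smul]
  conv_lhs => rw [lin]
  simp [MvPolynomial.smul_eq_C_mul, MvPolynomial.algebraMap_eq]

lemma exists_root {d : ℕ} (hd : 1 ≤ d) (t : ℂ) : ∃ u : ℂ, u ^ d = t :=
  IsAlgClosed.exists_pow_nat_eq t hd

lemma hasWaringDecomp_of_sum {ι : Type*} {d : ℕ} (hd : 1 ≤ d) {P : MvPolynomial σ ℂ}
    (J : Finset ι) (c : ι → ℂ) (L : ι → σ → ℂ) (h : P = ∑ j ∈ J, c j • lin (L j) ^ d) :
    HasWaringDecomp d P J.card := by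
  choose u hu using fun j => exists_root hd (c j)
  refine ⟨fun k => u (J.equivFin.symm k) • L (J.equivFin.symm k), ?_⟩
  rw [h, ← Finset.sum_coe_sort]
  refine Fintype.sum_equiv J.equivFin _ _ ?_
  intro x
  simp [lin_smul, smul_pow, hu]

lemma waringRank_le {ι : Type*} {d : ℕ} (hd : 1 ≤ d) {P : MvPolynomial σ ℂ}
    (J : Finset ι) (c : ι → ℂ) (L : ι → σ → ℂ) (h : P = ∑ j ∈ J, c j • lin (L j) ^ d) :
    waringRank d P ≤ J.card :=
  Nat.sInf_le (hasWaringDecomp_of_sum hd J c L h)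

lemma inWaringLocus_of_sum {ι : Type*} {d : ℕ} {P : MvPolynomial σ ℂ}
    (J : Finset ι) (c : ι → ℂ) (L : ι → σ → ℂ) (h : P = ∑ j ∈ J, c j • lin (L j) ^ d)
    (hJ : J.card = waringRank d P) {j₀ : ι} (hj₀ : j₀ ∈ J) : InWaringLocus d P (L j₀) := by
  let E := J.equivFinOfCardEq hJ
  refine ⟨fun k => c (E.symm k), fun k => L (E.symm k), E ⟨j₀, hj₀⟩, by simp, ?_⟩
  conv_lhs => rw [h, ← Finset.sum_coe_sort]
  refine Fintype.sum_equiv E _ _ ?_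
  intro x
  simp

/-- The submodule of polynomials with a Waring decomposition. -/
def waringSub (σ : Type*) [Fintype σ] (d : ℕ) (hd : 1 ≤ d) : Submodule ℂ (MvPolynomial σ ℂ) where
  carrier := {P | ∃ r, HasWaringDecomp d P r}
  zero_mem' := ⟨0, Fin.elim0, by simp⟩
  add_mem' := by
    rintro P Q ⟨r, L, hL⟩ ⟨r', L', hL'⟩
    refine ⟨r + r', Fin.append L L', ?_⟩
    rw [Fin.sum_univ_add]
    simp [hL, hL']
  smul_mem' := by
    rintro t P ⟨r, L, hL⟩
    obtain ⟨u, hu⟩ := exists_root hd t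
    refine ⟨r, fun j => u • L j, ?_⟩
    simp [hL, lin_smul, smul_pow, hu, Finset.smul_sum]

lemma lin_pow_mem (d : ℕ) (hd : 1 ≤ d) (c : σ → ℂ) : lin c ^ d ∈ waringSub σ d hd :=
  ⟨1, fun _ => c, by simp⟩

lemma lin_pow_mul_mem (n : ℕ) (a b : σ → ℂ) :
    lin a ^ n * lin b ∈ waringSub σ (n + 1) (Nat.le_add_left _ _) := by
  by_contra hv
  obtain ⟨f, hf, hle⟩ := Submodule.exists_le_ker_of_notMem hv
  let p : Polynomial ℂ := ∑ m ∈ Finset.range (n + 1 + 1),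
    Polynomial.C (f (lin b ^ m * lin a ^ (n + 1 - m) * ((n + 1).choose m : MvPolynomial σ ℂ)))
      * Polynomial.X ^ m
  have hp : p = 0 := by
    apply Polynomial.funext
    intro t
    have h1 : f ((lin (t • b + a)) ^ (n + 1)) = 0 := hle (lin_pow_mem _ _ _)
    rw [lin_add, lin_smul, add_pow, map_sum] at h1
    simp only [Polynomial.eval_zero, p, Polynomial.eval_finsetSum, Polynomial.eval_mul,
      Polynomial.eval_C, Polynomial.eval_pow, Polynomial.eval_X]
    rw [← h1]
    refine Finset.sum_congr rfl fun m _ => ?_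
    rw [smul_pow, smul_mul_assoc, smul_mul_assoc, map_smul, smul_eq_mul, mul_comm]
  have h2 : p.coeff 1 = 0 := by rw [hp]; simp
  simp only [p, Polynomial.finsetSum_coeff, Polynomial.coeff_C_mul_X_pow] at h2
  rw [Finset.sum_eq_single 1] at h2
  · have h3 : lin b ^ 1 * lin a ^ (n + 1 - 1) * ((n + 1).choose 1 : MvPolynomial σ ℂ)
        = ((n + 1 : ℕ) : ℂ) • (lin a ^ n * lin b) := by
      rw [MvPolynomial.smul_eq_C_mul]
      simp
      ring
    rw [if_pos rfl, h3, map_smul, smul_eq_mul, mul_eq_zero] at h2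
    rcases h2 with h2 | h2
    · exact absurd h2 (Nat.cast_ne_zero.mpr (Nat.succ_ne_zero n))
    · exact hf h2
  · intro m _ hm
    rw [if_neg (Ne.symm hm)]
  · intro h
    simp at h

lemma exists_lin {P : MvPolynomial σ ℂ} (h : P.IsHomogeneous 1) : ∃ c, P = lin c := by
  classical
  have h' : P ∈ homogeneousSubmodule σ ℂ 1 := h
  rw [homogeneousSubmodule_one_eq_span_X] at h'
  induction h' using Submodule.span_induction with
  | mem x hx => 
    obtain ⟨j, rfl⟩ := hx
    exact ⟨Pi.single j 1, by rw [lin_single, one_smul]⟩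
  | zero => exact ⟨0, lin_zero.symm⟩
  | add x y hx hy hx' hy' =>
    obtain ⟨c, rfl⟩ := hx' (by rw [homogeneousSubmodule_one_eq_span_X.symm] at hx; exact hx)
    obtain ⟨c', rfl⟩ := hy' (by rw [homogeneousSubmodule_one_eq_span_X.symm] at hy; exact hy)
    exact ⟨_, (lin_add _ _).symm⟩
  | smul t x hx hx' =>
    obtain ⟨c, rfl⟩ := hx' (by rw [homogeneousSubmodule_one_eq_span_X.symm] at hx; exact hx)
    exact ⟨_, (lin_smul _ _).symm⟩

lemma homogeneous_le_waringSub (d : ℕ) (hd : 1 ≤ d) :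
    homogeneousSubmodule σ ℂ d ≤ waringSub σ d hd := by
  induction d, hd using Nat.le_induction with
  | base =>
    intro P hP
    obtain ⟨c, rfl⟩ := exists_lin hP
    simpa using lin_pow_mem 1 le_rfl c
  | succ n hn ih =>
    rw [← homogeneousSubmodule_one_pow, pow_succ, homogeneousSubmodule_one_pow, Submodule.mul_le]
    intro P hP Q hQ
    obtain ⟨b, rfl⟩ := exists_lin hQ
    obtain ⟨r, L, rfl⟩ := ih hP
    rw [Finset.sum_mul]
    exact Submodule.sum_mem _ fun j _ => lin_pow_mul_mem n (L j) b

lemma hasWaringDecomp_rank {d : ℕ} (hd : 1 ≤ d) {P : MvPolynomial σ ℂ} (hP : P.IsHomogeneous d) :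
    HasWaringDecomp d P (waringRank d P) := by
  have : ∃ r, HasWaringDecomp d P r := homogeneous_le_waringSub d hd hP
  exact Nat.sInf_mem this

lemma pderiv_lin (c : σ → ℂ) (j : σ) : pderiv j (lin c) = C (c j) := by
  classical
  unfold lin
  rw [map_sum, Finset.sum_eq_single j]
  · simp
  · intro b _ hb
    simp [pderiv_X_of_ne hb]
  · simp

/-- Directional derivative. -/
lemma dir_lin_pow (e c : σ → ℂ) (d : ℕ) :
    ∑ j, e j • pderiv j (lin c ^ d) = ((d : ℂ) * ∑ j, e j * c j) • lin c ^ (d - 1) := by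
  simp only [pderiv_pow, pderiv_lin, Finset.mul_sum, Finset.sum_smul, MvPolynomial.smul_eq_C_mul]
  refine Finset.sum_congr rfl fun j _ => ?_
  simp
  ring

lemma vars_dir_subset (e : σ → ℂ) (S : Set σ) (P : MvPolynomial σ ℂ) (hP : ∀ j ∈ P.vars, j ∈ S) :
    ∀ j ∈ (∑ j, e j • pderiv j P).vars, j ∈ S := by
  have : (∑ j, e j • pderiv j P) ∈ supported ℂ S := by
    refine Subalgebra.sum_mem _ fun j _ => Subalgebra.smul_mem _ ?_ _
    rw [mem_supported]
    intro k hk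
    rw [Finset.mem_coe, mem_vars_iff_mem_support] at hk
    obtain ⟨m, hm, hk⟩ := hk
    apply hP
    rw [mem_vars_iff_mem_support]
    refine ⟨m + Finsupp.single j 1, ?_, ?_⟩
    · rw [mem_support_iff, coeff_pderiv] at hm
      rw [mem_support_iff]
      intro h
      simp [h] at hm
    · rw [Finsupp.mem_support_iff] at hk ⊢
      simp only [Finsupp.add_apply]
      omega
  rw [mem_supported] at this
  exact this

lemma homogeneous_dir (e : σ → ℂ) {d : ℕ} {P : MvPolynomial σ ℂ} (hP : P.IsHomogeneous d) :
    (∑ j, e j • pderiv j P).IsHomogeneous (d - 1) := by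
  refine IsHomogeneous.sum _ _ _ fun j _ => ?_
  rw [MvPolynomial.smul_eq_C_mul]
  exact hP.pderiv.C_mul _

lemma aeval_eq_self (g : σ → MvPolynomial σ ℂ) (P : MvPolynomial σ ℂ)
    (h : ∀ j ∈ P.vars, g j = X j) : aeval g P = P := by
  have := hom_congr_vars (f₁ := (aeval g : MvPolynomial σ ℂ →ₐ[ℂ] MvPolynomial σ ℂ).toRingHom)
    (f₂ := RingHom.id _) (p₁ := P) (p₂ := P) (by ext1; simp [MvPolynomial.algebraMap_eq])
    (by intro j hj _; simp [h j hj]) rfl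
  simpa using this

lemma aeval_scale (u : σ → ℂ) (t : ℂ) {m : ℕ} (P : MvPolynomial σ ℂ) (hP : P.IsHomogeneous m)
    (h : ∀ j ∈ P.vars, u j = t) : aeval (fun j => u j • (X j : MvPolynomial σ ℂ)) P = t ^ m • P := by
  conv_lhs => rw [P.as_sum, map_sum]
  conv_rhs => rw [P.as_sum, Finset.smul_sum]
  refine Finset.sum_congr rfl fun v hv => ?_
  rw [aeval_monomial, MvPolynomial.algebraMap_eq]
  have h1 : (v.prod fun i k => (u i • (X i : MvPolynomial σ ℂ)) ^ k)
      = v.prod fun i k => C (t ^ k) * X i ^ k := by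
    refine Finsupp.prod_congr fun i hi => ?_
    rw [h i ((mem_vars_iff_mem_support i).2 ⟨v, hv, hi⟩), smul_pow, MvPolynomial.smul_eq_C_mul]
  rw [h1, Finsupp.prod_mul]
  have h2 : (v.prod fun i k => (C (t ^ k) : MvPolynomial σ ℂ)) = C (t ^ m) := by
    rw [hP.degree_eq_sum_deg_support hv]
    simp [Finsupp.prod, Finset.prod_pow_eq_pow_sum]
  rw [h2, monomial_eq, MvPolynomial.smul_eq_C_mul]
  ring

lemma torus_avoid {s : ℕ} (q : Fin s → ℂ) (h : ∀ t : Fin s → ℂ, (∀ i, t i ≠ 0) → ∑ i, t i * q i ≠ 0) :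
    ∃ i, q i ≠ 0 ∧ ∀ k, k ≠ i → q k = 0 := by
  have h0 := h (fun _ => 1) (fun _ => one_ne_zero)
  obtain ⟨i, -, hi⟩ := Finset.exists_ne_zero_of_sum_ne_zero h0
  have hi' : q i ≠ 0 := by simpa using hi
  refine ⟨i, hi', ?_⟩
  intro k hk
  by_contra hq
  obtain ⟨A, hA⟩ : ∃ A, A = ∑ i, q i := ⟨_, rfl⟩
  obtain ⟨w, hw⟩ := Infinite.exists_notMem_finset ({-1, (q i - A) / q k} : Finset ℂ)
  simp only [Finset.mem_insert, Finset.mem_singleton, not_or] at hw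
  obtain ⟨hw1, hw2⟩ := hw
  obtain ⟨z, hz⟩ : ∃ z, z = -(A + w * q k) / q i := ⟨_, rfl⟩
  have hz1 : 1 + z ≠ 0 := by
    intro hh
    apply hw2
    have : z = -1 := by linear_combination hh
    rw [this] at hz
    field_simp at hz ⊢
    linear_combination hz
  have hw1' : 1 + w ≠ 0 := by
    intro hh
    apply hw1
    linear_combination hh
  refine h (fun l => 1 + (if l = i then z else 0) + (if l = k then w else 0)) ?_ ?_
  · intro l
    by_cases h1 : l = i
    · subst h1
      simpa [Ne.symm hk] using hz1
    · by_cases h2 : l = k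
      · subst h2
        simpa [h1] using hw1'
      · simp [h1, h2]
  · simp only [add_mul, Finset.sum_add_distrib, one_mul, ite_mul, zero_mul, Finset.sum_ite_eq',
      Finset.mem_univ, if_true, ← hA]
    rw [hz]
    field_simp
    ring

end helpers

section blocks

variable {s : ℕ} {n : Fin s → ℕ}

/-- rescaling of blocks of variables applied to a power sum -/
lemma aeval_scale_lin (u : Fin s → ℂ) (c : ((i : Fin s) × Fin (n i + 1)) → ℂ) :
    aeval (fun j : (i : Fin s) × Fin (n i + 1) =>
      u j.1 • (X j : MvPolynomial ((i : Fin s) × Fin (n i + 1)) ℂ)) (lin c)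
      = lin (fun j => u j.1 * c j) := by
  simp only [lin, map_sum, map_mul, aeval_X, aeval_C, MvPolynomial.algebraMap_eq,
    MvPolynomial.smul_eq_C_mul]
  refine Finset.sum_congr rfl fun j _ => ?_
  ring

/-- Minimal decompositions of a form in block `i` only involve the block `i`. -/
lemma block_of_minimal {ι : Type*} {d : ℕ} (hd : 1 ≤ d) (i : Fin s)
    (P : MvPolynomial ((i : Fin s) × Fin (n i + 1)) ℂ) (hP : ∀ j ∈ P.vars, j.1 = i)
    (J : Finset ι) (c : ι → ℂ) (L : ι → ((i : Fin s) × Fin (n i + 1)) → ℂ)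
    (h : P = ∑ j ∈ J, c j • lin (L j) ^ d) (hJ : J.card = waringRank d P)
    (j : ι) (hj : j ∈ J) (y : (i : Fin s) × Fin (n i + 1)) (hy : y.1 ≠ i) : L j y = 0 := by
  classical
  by_contra hne
  let M : ((i : Fin s) × Fin (n i + 1)) → ((i : Fin s) × Fin (n i + 1)) → ℂ := fun k =>
    if k = y then (fun l => if l = y then 0 else -(L j l) / (L j y)) else Pi.single k 1
  have h1 : aeval (fun k => lin (M k)) P = P := by
    apply aeval_eq_self
    intro k hk
    have : k ≠ y := by
      rintro rfl
      exact hy (hP _ hk)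
    simp [M, this, lin_single]
  have h2 : ∑ k, L j k • M k = 0 := by
    rw [← Finset.add_sum_erase _ _ (Finset.mem_univ y)]
    funext l
    simp only [Pi.add_apply, Finset.sum_apply, Pi.smul_apply, smul_eq_mul, Pi.zero_apply]
    have h3 : ∀ k ∈ Finset.univ.erase y, L j k * M k l = if k = l then L j k else 0 := by
      intro k hk
      have hk' : k ≠ y := Finset.ne_of_mem_erase hk
      by_cases hkl : k = l
      · subst hkl
        simp [M, hk']
      · simp [M, hk', hkl, Ne.symm hkl]
    rw [Finset.sum_congr rfl h3, Finset.sum_ite_eq']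
    by_cases hl : l = y
    · simp [M, hl]
    · simp only [M, hl, if_true, if_false, Finset.mem_erase, Finset.mem_univ, and_true, ne_eq,
        not_false_eq_true]
      field_simp
      ring
  have h4 : P = ∑ k ∈ J.erase j, c k • lin (∑ l, L k l • M l) ^ d := by
    rw [← Finset.add_sum_erase _ _ hj] at h
    conv_lhs => rw [← h1, h]
    rw [map_add, map_sum]
    simp only [map_smul, map_pow, aeval_lin, h2, lin_zero]
    rw [zero_pow (by omega), smul_zero, zero_add]
  have h5 := waringRank_le hd _ _ _ h4
  rw [Finset.card_erase_of_mem hj] at h5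
  have := Finset.card_pos.2 ⟨j, hj⟩
  omega

lemma locus_forward (d : ℕ) (hd : 2 ≤ d)
    (F : Fin s → MvPolynomial ((i : Fin s) × Fin (n i + 1)) ℂ)
    (hFhom : ∀ i, (F i).IsHomogeneous d)
    (hFvars : ∀ i, ∀ j ∈ (F i).vars, j.1 = i)
    (e : Fin s → ((i : Fin s) × Fin (n i + 1)) → ℂ)
    (he : ∀ i j, j.1 ≠ i → e i j = 0)
    (h1 : ∀ i, waringRank (d - 1) (∑ j, e i j • pderiv j (F i)) = waringRank d (F i))
    (h2 : waringRank d (∑ i, F i) = ∑ i, waringRank d (F i))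
    (h3 : waringRank (d - 1) (∑ i, ∑ j, e i j • pderiv j (F i))
        = ∑ i, waringRank (d - 1) (∑ j, e i j • pderiv j (F i)))
    (a : ((i : Fin s) × Fin (n i + 1)) → ℂ) (ha : InWaringLocus d (∑ i, F i) a) :
    ∃ i, (∀ j : (k : Fin s) × Fin (n k + 1), j.1 ≠ i → a j = 0) ∧ InWaringLocus d (F i) a := by
  classical
  unfold InWaringLocus at ha
  obtain ⟨r, hr⟩ : ∃ r, r = waringRank d (∑ i, F i) := ⟨_, rfl⟩
  rw [← hr] at ha h2
  obtain ⟨c, L, j₀, rfl, hF⟩ := ha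
  have hd1 : 1 ≤ d - 1 := by omega
  let G : Fin s → MvPolynomial ((i : Fin s) × Fin (n i + 1)) ℂ :=
    fun i => ∑ j, e i j • pderiv j (F i)
  have hGhom : ∀ i, (G i).IsHomogeneous (d - 1) := fun i => homogeneous_dir _ (hFhom i)
  have hGvars : ∀ i, ∀ j ∈ (G i).vars, j.1 = i := fun i =>
    vars_dir_subset (e i) {j | j.1 = i} (F i) (hFvars i)
  let p : Fin s → Fin r → ℂ := fun i j => ∑ k, e i k * L j k
  have hG : ∀ i, G i = ∑ j, (c j * (d * p i j)) • lin (L j) ^ (d - 1) := by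
    intro i
    have hD : G i = ∑ k, e i k • pderiv k (∑ i, F i) := by
      refine Finset.sum_congr rfl fun k _ => ?_
      by_cases hk : k.1 = i
      · rw [map_sum, Finset.sum_eq_single i]
        · intro l _ hl
          apply pderiv_eq_zero_of_notMem_vars
          intro hmem
          exact hl ((hFvars l k hmem).symm.trans hk)
        · simp
      · rw [he i k hk, zero_smul, zero_smul]
    rw [hD, hF]
    simp only [map_sum, Finset.smul_sum]
    rw [Finset.sum_comm]
    refine Finset.sum_congr rfl fun j _ => ?_
    rw [mul_smul, ← dir_lin_pow, Finset.smul_sum]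
    refine Finset.sum_congr rfl fun k _ => ?_
    rw [Derivation.map_smul, smul_comm]
  have hrG : waringRank (d - 1) (∑ i, G i) = r := by
    rw [h2, h3]
    exact Finset.sum_congr rfl fun i _ => h1 i
  have hA : ∀ j, ∀ t : Fin s → ℂ, (∀ i, t i ≠ 0) → ∑ i, t i * p i j ≠ 0 := by
    intro j t ht h0
    choose u hu using fun i => exists_root hd1 (t i)⁻¹
    have e1 : ∑ i, t i • G i
        = ∑ k ∈ Finset.univ.erase j, (c k * (d * ∑ i, t i * p i k)) • lin (L k) ^ (d - 1) := by
      have e2 : ∑ i, t i • G i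
          = ∑ k, (c k * (d * ∑ i, t i * p i k)) • lin (L k) ^ (d - 1) := by
        simp only [hG, Finset.smul_sum, Finset.mul_sum, Finset.sum_smul]
        rw [Finset.sum_comm]
        refine Finset.sum_congr rfl fun k _ => Finset.sum_congr rfl fun i _ => ?_
        rw [smul_smul]
        congr 1
        ring
      rw [e2, ← Finset.add_sum_erase _ _ (Finset.mem_univ j), h0]
      simp
    have e3 := congrArg (aeval (fun j : (i : Fin s) × Fin (n i + 1) =>
      u j.1 • (X j : MvPolynomial ((i : Fin s) × Fin (n i + 1)) ℂ))) e1
    simp only [map_sum, map_smul, map_pow, aeval_scale_lin] at e3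
    have e4 : ∑ i, G i = ∑ i, t i • aeval (fun j : (i : Fin s) × Fin (n i + 1) =>
      u j.1 • (X j : MvPolynomial ((i : Fin s) × Fin (n i + 1)) ℂ)) (G i) := by
      refine Finset.sum_congr rfl fun i _ => ?_
      rw [aeval_scale (fun j => u j.1) (u i) (G i) (hGhom i)
        (fun j hj => by rw [hGvars i j hj]), hu, smul_smul, mul_inv_cancel₀ (ht i), one_smul]
    rw [← e4] at e3
    have e5 := waringRank_le hd1 _ _ _ e3
    rw [hrG, Finset.card_erase_of_mem (Finset.mem_univ j), Finset.card_univ, Fintype.card_fin] at e5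
    have := j.pos
    omega
  choose β hβ hβ' using fun j => torus_avoid (fun i => p i j) (hA j)
  let J : Fin s → Finset (Fin r) := fun i => Finset.univ.filter fun j => β j = i
  have hGJ : ∀ i, G i = ∑ j ∈ J i, (c j * (d * p i j)) • lin (L j) ^ (d - 1) := by
    intro i
    rw [hG i]
    symm
    apply Finset.sum_subset (Finset.subset_univ _)
    intro j _ hj
    have : i ≠ β j := by
      intro hh
      exact hj (by simp [J, hh])
    rw [hβ' j i this]
    simp
  have hle : ∀ i ∈ Finset.univ, waringRank (d - 1) (G i) ≤ (J i).card := fun i _ =>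
    waringRank_le hd1 _ _ _ (hGJ i)
  have hsum : ∑ i, waringRank (d - 1) (G i) = ∑ i, (J i).card := by
    rw [← h3, hrG]
    have := Finset.card_eq_sum_card_fiberwise (s := (Finset.univ : Finset (Fin r))) (f := β)
      (t := Finset.univ) (by intro x _; simp)
    rw [Finset.card_univ, Fintype.card_fin] at this
    exact this
  have hcard : ∀ i, (J i).card = waringRank (d - 1) (G i) := fun i =>
    ((Finset.sum_eq_sum_iff_of_le hle).1 hsum i (Finset.mem_univ i)).symm
  have hblock : ∀ j, ∀ y : (i : Fin s) × Fin (n i + 1), y.1 ≠ β j → L j y = 0 := fun j y hy =>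
    block_of_minimal hd1 (β j) (G (β j)) (hGvars _) (J (β j)) _ L (hGJ _) (hcard _) j
      (by simp [J]) y hy
  have hFJ : ∀ i, F i = ∑ j ∈ J i, c j • lin (L j) ^ d := by
    intro i
    have e3 := congrArg (aeval (fun j : (i : Fin s) × Fin (n i + 1) =>
      (if j.1 = i then (1 : ℂ) else 0) •
        (X j : MvPolynomial ((i : Fin s) × Fin (n i + 1)) ℂ))) hF
    simp only [map_sum, map_smul, map_pow,
      aeval_scale_lin (fun k : Fin s => if k = i then (1 : ℂ) else 0)] at e3
    rw [Finset.sum_eq_single i] at e3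
    · rw [aeval_scale _ 1 (F i) (hFhom i) (fun j hj => by simp [hFvars i j hj])] at e3
      rw [one_pow, one_smul] at e3
      rw [e3]
      symm
      apply Finset.sum_subset_zero_on_sdiff (Finset.subset_univ _)
      · intro j hj
        have hj' : β j ≠ i := by simpa [J] using hj
        have : (fun k : (i : Fin s) × Fin (n i + 1) =>
            (if k.1 = i then (1 : ℂ) else 0) * L j k) = 0 := by
          funext k
          by_cases hk : k.1 = i
          · simp [hblock j k (by rw [hk]; exact Ne.symm hj')]
          · simp [hk]
        rw [this, lin_zero, zero_pow (by omega), smul_zero]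
      · intro j hj
        have hj' : β j = i := by simpa [J] using hj
        congr 3
        funext k
        by_cases hk : k.1 = i
        · simp [hk]
        · simp [hblock j k (by rw [hj']; exact hk)]
    · intro l _ hl
      rw [aeval_scale _ 0 (F l) (hFhom l) (fun j hj => by simp [hFvars l j hj, hl]),
        zero_pow (by omega), zero_smul]
    · simp
  exact ⟨β j₀, hblock j₀, inWaringLocus_of_sum (J (β j₀)) c L (hFJ _)
    ((hcard _).trans (h1 _)) (j₀ := j₀) (by simp [J])⟩

end blocks

/-- sufficient conditions for the Waring-locus version of Strassen's
conjecture.  The variables are indexed by the sigma type `(i : Fin s) × Fin (n i + 1)`,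
block `i` corresponding to `x_{i,0}, …, x_{i,n_i}`.  If each `Fᵢ` is a nonzero degree-`d`
form in the `i`-th block of variables, each admits a linear differential operator
`∂ᵢ = ∑ e i j ∂_{x_j}` (supported in block `i`) preserving the rank, and Strassen
additivity of rank holds for `∑ Fᵢ` and for `∑ ∂ᵢ∘Fᵢ`, then the Waring locus of
`F = ∑ Fᵢ` is the union of the Waring loci of the `Fᵢ`. -/
theorem waring_locus_union_of_blocks (s : ℕ) (n : Fin s → ℕ) (d : ℕ)
    (F : Fin s → MvPolynomial ((i : Fin s) × Fin (n i + 1)) ℂ)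
    (hFne : ∀ i, F i ≠ 0) (hFhom : ∀ i, (F i).IsHomogeneous d)
    (hFvars : ∀ i, ∀ j ∈ (F i).vars, j.1 = i)
    (e : Fin s → ((i : Fin s) × Fin (n i + 1)) → ℂ)
    (he : ∀ i j, j.1 ≠ i → e i j = 0)
    (h1 : ∀ i, waringRank (d - 1) (∑ j, e i j • pderiv j (F i)) = waringRank d (F i))
    (h2 : waringRank d (∑ i, F i) = ∑ i, waringRank d (F i))
    (h3 : waringRank (d - 1) (∑ i, ∑ j, e i j • pderiv j (F i))
        = ∑ i, waringRank (d - 1) (∑ j, e i j • pderiv j (F i))) :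
    ∀ a : ((i : Fin s) × Fin (n i + 1)) → ℂ, a ≠ 0 →
      (InWaringLocus d (∑ i, F i) a ↔
        ∃ i, (∀ j : (k : Fin s) × Fin (n k + 1), j.1 ≠ i → a j = 0) ∧
          InWaringLocus d (F i) a) := by
  intro a _
  rcases Nat.eq_zero_or_pos d with rfl | hd
  · have hz : ∀ i, waringRank 0 (F i) = 0 := by
      intro i
      have hc : ∀ j, pderiv j (F i) = 0 := by
        intro j
        have := hFhom i
        rw [← totalDegree_zero_iff_isHomogeneous, totalDegree_eq_zero_iff_eq_C] at this
        rw [this, pderiv_C]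
      rw [← h1 i]
      simp only [hc, smul_zero, Finset.sum_const_zero]
      exact Nat.le_zero.1 (Nat.sInf_le ⟨Fin.elim0, by simp⟩)
    constructor
    · rintro ⟨_, _, j₀, _⟩
      have := j₀.pos
      rw [h2] at this
      simp [hz] at this
    · rintro ⟨i, _, _, _, j₀, _⟩
      have := j₀.pos
      rw [hz] at this
      omega
  constructor
  · intro ha
    rcases Nat.lt_or_ge 1 d with hd2 | hd2
    · exact locus_forward d hd2 F hFhom hFvars e he h1 h2 h3 a ha
    · obtain rfl : d = 1 := by omega
      have hpos : ∀ i ∈ Finset.univ, 1 ≤ waringRank 1 (F i) := by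
        intro i _
        by_contra hlt
        have h0 : waringRank 1 (F i) = 0 := by omega
        obtain ⟨L, hL⟩ := hasWaringDecomp_rank hd (hFhom i)
        apply hFne i
        rw [hL]
        apply Finset.sum_eq_zero
        intro x
        have := x.pos
        omega
      have hle : waringRank 1 (∑ i, F i) ≤ 1 := by
        obtain ⟨c, hc⟩ := exists_lin (IsHomogeneous.sum Finset.univ F 1 fun i _ => hFhom i)
        exact Nat.sInf_le ⟨fun _ => c, by simp [hc]⟩
      have hs := Finset.sum_le_sum hpos
      simp only [Finset.sum_const, Finset.card_univ, Fintype.card_fin, smul_eq_mul, mul_one] at hs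
      have hr : 0 < waringRank 1 (∑ i, F i) := by
        obtain ⟨_, _, j₀, _⟩ := ha
        exact j₀.pos
      have hs0 : 0 < s := by
        rcases Nat.eq_zero_or_pos s with rfl | h
        · rw [h2] at hr
          simp at hr
        · exact h
      obtain rfl : s = 1 := by omega
      refine ⟨0, fun j hj => absurd (Subsingleton.elim _ _) hj, ?_⟩
      rwa [Fin.sum_univ_one] at ha
  · rintro ⟨i, -, c₀, L₀, j₀, hj₀, hF₀⟩
    have hk : ∀ k, ∃ (c : Fin (waringRank d (F k)) → ℂ)
        (L : Fin (waringRank d (F k)) → ((i : Fin s) × Fin (n i + 1)) → ℂ),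
        F k = ∑ j, c j • lin (L j) ^ d ∧ (k = i → ∃ j, L j = a) := by
      intro k
      by_cases hki : k = i
      · subst hki
        exact ⟨c₀, L₀, hF₀, fun _ => ⟨j₀, hj₀⟩⟩
      · obtain ⟨L, hL⟩ := hasWaringDecomp_rank hd (hFhom k)
        exact ⟨fun _ => 1, L, by simpa using hL, fun h => absurd h hki⟩
    choose c L hcL hi using hk
    obtain ⟨j, hj⟩ := hi i rfl
    have := inWaringLocus_of_sum (d := d) (P := ∑ k, F k)
      (Finset.univ : Finset ((k : Fin s) × Fin (waringRank d (F k))))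
      (fun x => c x.1 x.2) (fun x => L x.1 x.2)
      (by rw [Fintype.sum_sigma]; exact Finset.sum_congr rfl fun k _ => hcL k)
      (by rw [h2]; simp) (Finset.mem_univ ⟨i, j⟩)
    rw [← hj]
    exact this

end
end
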